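/- arXiv:1504.06280 — 2 statements merged into one kernel-verified Lean document; each statement's English description precedes it below -/
import Mathlib

section
/- For every distribution η on R, lim_{n→∞} E_η^{U,n}[U_1]/n = λ where λ = p̄/(1−p̄). Moreover there are constants C, c > 0 such that for every n ∈ ℕ and every distribution η on R, |E_η^{U,n}[U_1] − λn − η·𝐫| ≤ C e^{−cn}, where 𝐫 = (I − K + (𝟏−𝐩)μD_{1−p}K/(1−p̄))^{−1}𝐩 − λ𝟏. -/
open MeasureTheory Filter Set Matrix ProbabilityTheory
open scoped Classical

noncomputable section

/-- `K` is a (row-)stochastic matrix. -/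
def IsStochastic {n : Type*} [Fintype n] (K : Matrix n n ℝ) : Prop :=
  (∀ i j, 0 ≤ K i j) ∧ ∀ i, ∑ j, K i j = 1

/-- `v` is a probability (row) vector. -/
def IsProbVec {n : Type*} [Fintype n] (v : n → ℝ) : Prop :=
  (∀ i, 0 ≤ v i) ∧ ∑ i, v i = 1

/-- `μ` is a stationary distribution for `K`, i.e. `μ K = μ`. -/
def IsStationaryDist {n : Type*} [Fintype n] (K : Matrix n n ℝ) (μ : n → ℝ) : Prop :=
  IsProbVec μ ∧ Matrix.vecMul μ K = μ

/-- `μ` is the unique stationary distribution of `K` (equivalent, for a finite chain, to `K`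
having a unique closed irreducible subset). -/
def HasUniqueStationaryDist {n : Type*} [Fintype n] (K : Matrix n n ℝ) (μ : n → ℝ) : Prop :=
  IsStationaryDist K μ ∧ ∀ μ' : n → ℝ, IsStationaryDist K μ' → μ' = μ

/-- `(Pm, Rc, ξ)` is the (averaged) law of the environment and coin tosses at a single site:
`Rc` is a Markov chain with transition matrix `K` and initial distribution `η`
(0-based indexing: `Rc j` is `R_{j+1}` of the paper) and, conditionally on the chain, the
`ξ j` are independent Bernoulli with success probability `p (Rc j)`. -/
def IsCookieSite {N : ℕ} {Ω : Type*} [MeasurableSpace Ω] (Pm : Measure Ω)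
    (K : Matrix (Fin N) (Fin N) ℝ) (p η : Fin N → ℝ)
    (Rc : ℕ → Ω → Fin N) (ξ : ℕ → Ω → Bool) : Prop :=
  (∀ j, Measurable (Rc j)) ∧ (∀ j, Measurable (ξ j)) ∧
    ∀ (m : ℕ) (f : ℕ → Fin N) (b : ℕ → Bool),
      (Pm {ω | ∀ j ≤ m, Rc j ω = f j ∧ ξ j ω = b j}).toReal =
        η (f 0) * (∏ j ∈ Finset.range m, K (f j) (f (j + 1))) *
          ∏ j ∈ Finset.range (m + 1), (if b j then p (f j) else 1 - p (f j))

/-- `numSucc ξx m` = number of successes before the `m`-th failure in the Bernoulli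
sequence `ξx` (the quantity `S_m` of the paper). -/
def numSucc (ξx : ℕ → Bool) (m : ℕ) : ℕ :=
  sInf {k | ((Finset.range (k + m)).filter fun j => ξx j = false).card = m}

/-- `numFail ξx m` = number of failures before the `m`-th success in the Bernoulli
sequence `ξx` (the quantity `F_m` of the paper). -/
def numFail (ξx : ℕ → Bool) (m : ℕ) : ℕ :=
  sInf {k | ((Finset.range (k + m)).filter fun j => ξx j = true).card = m}

/-- The forward branching-like process: `U_0 = y`, `U_i = S^i_{U_{i−1}}`. -/
def Uproc (ξ : ℤ → ℕ → Bool) (y : ℕ) : ℕ → ℕ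
  | 0 => y
  | i + 1 => numSucc (ξ ((i : ℤ) + 1)) (Uproc ξ y i)

/-- The backward branching-like process: `V_0 = y`, `V_i = F^i_{V_{i−1}+1}`. -/
def Vproc (ξ : ℤ → ℕ → Bool) (y : ℕ) : ℕ → ℕ
  | 0 => y
  | i + 1 => numFail (ξ ((i : ℤ) + 1)) (Vproc ξ y i + 1)

/-- The vector `𝐫 = (I − K + (𝟏−𝐩)μD_{1−p}K/(1−p̄))⁻¹ 𝐩 − λ𝟏`, `λ = p̄/(1−p̄)`. -/
def rvecGen {N : ℕ} (K : Matrix (Fin N) (Fin N) ℝ) (μ p : Fin N → ℝ) : Fin N → ℝ :=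
  Matrix.mulVec
    (1 - K + (1 / (1 - ∑ i, μ i * p i)) •
        Matrix.vecMulVec (fun i => 1 - p i)
          (Matrix.vecMul μ (Matrix.diagonal (fun i => 1 - p i) * K)))⁻¹ p
    - ((∑ i, μ i * p i) / (1 - ∑ i, μ i * p i)) • (1 : Fin N → ℝ)

/-! ### Stationary distributions of finite stochastic matrices -/

lemma IsStochastic.mulVec_nonneg {n : Type*} [Fintype n] {K : Matrix n n ℝ}
    (hK : IsStochastic K) {h : n → ℝ} (hh : ∀ i, 0 ≤ h i) (i : n) :
    0 ≤ (K *ᵥ h) i :=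
  Finset.sum_nonneg fun j _ => mul_nonneg (hK.1 i j) (hh j)

lemma IsStochastic.mulVec_one {n : Type*} [Fintype n] {K : Matrix n n ℝ}
    (hK : IsStochastic K) : K *ᵥ 1 = 1 := by
  ext i
  simp [Matrix.mulVec, dotProduct, hK.2 i]

lemma IsStochastic.sum_vecMul {n : Type*} [Fintype n] {K : Matrix n n ℝ}
    (hK : IsStochastic K) (v : n → ℝ) :
    ∑ l, (v ᵥ* K) l = ∑ i, v i := by
  simp only [Matrix.vecMul, dotProduct]
  rw [Finset.sum_comm]
  simp [← Finset.mul_sum, hK.2]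

lemma sum_mul_lt_one {n : Type*} [Fintype n] {μ p : n → ℝ} (hμ : IsProbVec μ)
    (hp : ∀ i, p i ∈ Ioo (0 : ℝ) 1) :
    ∑ i, μ i * p i < 1 := by
  obtain ⟨j, hj⟩ : ∃ j, μ j ≠ 0 := by
    by_contra! h
    simpa [h] using hμ.2
  rw [← hμ.2]
  refine Finset.sum_lt_sum (fun i _ => mul_le_of_le_one_right (hμ.1 i) (hp i).2.le)
    ⟨j, Finset.mem_univ j, ?_⟩
  exact mul_lt_of_lt_one_right (lt_of_le_of_ne (hμ.1 j) hj.symm) (hp j).2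

lemma IsStochastic.exists_isStationaryDist {n : Type*} [Fintype n] [DecidableEq n] [Nonempty n]
    {K : Matrix n n ℝ} (hK : IsStochastic K) : ∃ ν, IsStationaryDist K ν := by
  have hdet : (K - 1).det = 0 := by
    refine Matrix.exists_mulVec_eq_zero_iff.1 ⟨1, one_ne_zero, ?_⟩
    ext i
    rw [Matrix.sub_mulVec, hK.mulVec_one]
    simp
  obtain ⟨v, hv0, hv⟩ := Matrix.exists_vecMul_eq_zero_iff.2 hdet
  have hvK : ∀ j, ∑ i, v i * K i j = v j := by
    intro j
    have := congrFun hv j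
    simp only [Matrix.vecMul_sub, Matrix.vecMul_one, Pi.sub_apply, Pi.zero_apply] at this
    simpa [Matrix.vecMul, dotProduct, sub_eq_zero] using this
  have hle : ∀ j, |v j| ≤ ∑ i, |v i| * K i j := by
    intro j
    rw [← hvK j]
    refine (Finset.abs_sum_le_sum_abs _ _).trans (le_of_eq ?_)
    refine Finset.sum_congr rfl fun i _ => ?_
    rw [abs_mul, abs_of_nonneg (hK.1 i j)]
  have hsum : ∑ j, |v j| = ∑ j, ∑ i, |v i| * K i j := by
    rw [Finset.sum_comm]
    simp [← Finset.mul_sum, hK.2]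
  have heq : ∀ j, |v j| = ∑ i, |v i| * K i j := fun j =>
    (Finset.sum_eq_sum_iff_of_le fun j _ => hle j).1 hsum j (Finset.mem_univ j)
  obtain ⟨i₀, hi₀⟩ := Function.ne_iff.1 hv0
  have hpos : 0 < ∑ i, |v i| :=
    Finset.sum_pos' (fun i _ => abs_nonneg _) ⟨i₀, Finset.mem_univ _, abs_pos.2 hi₀⟩
  refine ⟨fun i => |v i| / ∑ i, |v i|, ⟨fun i => by positivity, ?_⟩, ?_⟩
  · rw [← Finset.sum_div, div_self hpos.ne']
  · ext j
    simp only [Matrix.vecMul, dotProduct, div_mul_eq_mul_div]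
    rw [← Finset.sum_div, ← heq j]

lemma IsStochastic.exists_isStationaryDist_of_closed {n : Type*} [Fintype n] [DecidableEq n]
    {K : Matrix n n ℝ} (hK : IsStochastic K) {S : Finset n} (hS : S.Nonempty)
    (hclosed : ∀ i ∈ S, ∀ l ∉ S, K i l = 0) :
    ∃ ν, IsStationaryDist K ν ∧ ∀ i ∉ S, ν i = 0 := by
  have hext : ∀ g : n → ℝ, (∀ i ∉ S, g i = 0) → ∑ i, g i = ∑ i : S, g i := fun g hg => by
    rw [Finset.sum_coe_sort S g]
    exact (Finset.sum_subset (Finset.subset_univ S) fun i _ hi => hg i hi).symm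
  have : Nonempty S := hS.to_subtype
  have hM : IsStochastic (K.submatrix ((↑) : S → n) (↑)) := by
    refine ⟨fun i j => hK.1 _ _, fun i => ?_⟩
    rw [← hK.2 i, hext _ fun l hl => hclosed i i.2 l hl]
    rfl
  obtain ⟨ν, ⟨hν0, hν1⟩, hν⟩ := hM.exists_isStationaryDist
  have hin : ∀ i : S, (if h : (i : n) ∈ S then ν ⟨i, h⟩ else 0) = ν i := fun i => by simp
  refine ⟨fun i => if h : i ∈ S then ν ⟨i, h⟩ else 0, ⟨⟨fun i => ?_, ?_⟩, ?_⟩, fun i hi => ?_⟩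
  · dsimp only
    split_ifs
    exacts [hν0 _, le_rfl]
  · rw [hext _ fun i hi => by simp [hi]]
    simp only [hin, hν1]
  · ext j
    simp only [Matrix.vecMul, dotProduct]
    rw [hext _ fun i hi => by simp [hi]]
    simp only [hin]
    split_ifs with hj
    · exact congrFun hν ⟨j, hj⟩
    · exact Finset.sum_eq_zero fun i _ => by rw [hclosed i i.2 j hj, mul_zero]
  · simp [hi]

/-! ### The chain observed at failure times -/

section FailureChain

variable {n : Type*} [Fintype n] [DecidableEq n]

/-- The matrix `I - D_p K`. -/
def succMat (K : Matrix n n ℝ) (p : n → ℝ) : Matrix n n ℝ := 1 - Matrix.diagonal p * K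

/-- The matrix `D_{1-p} K`. -/
def failMat (K : Matrix n n ℝ) (p : n → ℝ) : Matrix n n ℝ := Matrix.diagonal (fun i => 1 - p i) * K

/-- The transition matrix of the cookie chain observed right after each failure. -/
def failChain (K : Matrix n n ℝ) (p : n → ℝ) : Matrix n n ℝ := (succMat K p)⁻¹ * failMat K p

/-- The expected number of successes before the `m`-th failure, as a function of the
initial state. -/
def meanSucc (K : Matrix n n ℝ) (p : n → ℝ) : ℕ → n → ℝ
  | 0 => 0
  | m + 1 => (succMat K p)⁻¹ *ᵥ (p + failMat K p *ᵥ meanSucc K p m)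

variable {K : Matrix n n ℝ} {p μ : n → ℝ}

lemma succMat_mulVec_apply (h : n → ℝ) (i : n) :
    (succMat K p *ᵥ h) i = h i - p i * (K *ᵥ h) i := by
  simp [succMat, Matrix.sub_mulVec, ← Matrix.mulVec_mulVec, Matrix.mulVec_diagonal]

lemma failMat_mulVec_apply (h : n → ℝ) (i : n) :
    (failMat K p *ᵥ h) i = (1 - p i) * (K *ᵥ h) i := by
  simp [failMat, ← Matrix.mulVec_mulVec, Matrix.mulVec_diagonal]

lemma nonneg_of_succMat_mulVec_nonneg (hK : IsStochastic K) (hp : ∀ i, p i ∈ Ioo (0 : ℝ) 1)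
    {h : n → ℝ} (hh : ∀ i, 0 ≤ (succMat K p *ᵥ h) i) (i : n) : 0 ≤ h i := by
  obtain ⟨m, -, hm⟩ := Finset.exists_min_image Finset.univ h ⟨i, Finset.mem_univ i⟩
  refine le_trans ?_ (hm i (Finset.mem_univ i))
  have h1 : h m ≤ (K *ᵥ h) m := by
    calc h m = ∑ j, K m j * h m := by rw [← Finset.sum_mul, hK.2, one_mul]
      _ ≤ ∑ j, K m j * h j := Finset.sum_le_sum fun j hj =>
          mul_le_mul_of_nonneg_left (hm j hj) (hK.1 m j)
  have h2 := hh m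
  rw [succMat_mulVec_apply] at h2
  obtain ⟨hp0, hp1⟩ := hp m
  nlinarith

lemma isUnit_det_succMat (hK : IsStochastic K) (hp : ∀ i, p i ∈ Ioo (0 : ℝ) 1) :
    IsUnit (succMat K p).det := by
  rw [isUnit_iff_ne_zero]
  intro h0
  obtain ⟨v, hv, hv0⟩ := Matrix.exists_mulVec_eq_zero_iff.2 h0
  refine hv (funext fun i => le_antisymm ?_ ?_)
  · have := nonneg_of_succMat_mulVec_nonneg hK hp (h := -v) (by simp [Matrix.mulVec_neg, hv0]) i
    simpa using this
  · exact nonneg_of_succMat_mulVec_nonneg hK hp (by simp [hv0]) i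

lemma succMat_mulVec_inv (hK : IsStochastic K) (hp : ∀ i, p i ∈ Ioo (0 : ℝ) 1) (v : n → ℝ) :
    succMat K p *ᵥ ((succMat K p)⁻¹ *ᵥ v) = v := by
  rw [Matrix.mulVec_mulVec, Matrix.mul_nonsing_inv _ (isUnit_det_succMat hK hp), Matrix.one_mulVec]

lemma inv_mulVec_succMat (hK : IsStochastic K) (hp : ∀ i, p i ∈ Ioo (0 : ℝ) 1) (v : n → ℝ) :
    (succMat K p)⁻¹ *ᵥ (succMat K p *ᵥ v) = v := by
  rw [Matrix.mulVec_mulVec, Matrix.nonsing_inv_mul _ (isUnit_det_succMat hK hp), Matrix.one_mulVec]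

lemma succMat_mulVec_failChain (hK : IsStochastic K) (hp : ∀ i, p i ∈ Ioo (0 : ℝ) 1)
    (v : n → ℝ) : succMat K p *ᵥ (failChain K p *ᵥ v) = failMat K p *ᵥ v := by
  rw [failChain, ← Matrix.mulVec_mulVec, succMat_mulVec_inv hK hp]

lemma failChain_mulVec_eq_iff (hK : IsStochastic K) (hp : ∀ i, p i ∈ Ioo (0 : ℝ) 1)
    {v w : n → ℝ} : failChain K p *ᵥ v = w ↔ failMat K p *ᵥ v = succMat K p *ᵥ w := by
  constructor
  · rintro rfl
    rw [succMat_mulVec_failChain hK hp]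
  · intro h
    rw [failChain, ← Matrix.mulVec_mulVec, h, inv_mulVec_succMat hK hp]

lemma failChain_mulVec_one (hK : IsStochastic K) (hp : ∀ i, p i ∈ Ioo (0 : ℝ) 1) :
    failChain K p *ᵥ 1 = 1 := by
  rw [failChain_mulVec_eq_iff hK hp]
  ext i
  simp [succMat_mulVec_apply, failMat_mulVec_apply, hK.mulVec_one]

lemma failChain_mulVec_nonneg (hK : IsStochastic K) (hp : ∀ i, p i ∈ Ioo (0 : ℝ) 1)
    {v : n → ℝ} (hv : ∀ i, 0 ≤ v i) (i : n) : 0 ≤ (failChain K p *ᵥ v) i := by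
  refine nonneg_of_succMat_mulVec_nonneg hK hp (fun j => ?_) i
  rw [succMat_mulVec_failChain hK hp, failMat_mulVec_apply]
  exact mul_nonneg (by linarith [(hp j).2]) (hK.mulVec_nonneg hv j)

lemma isStochastic_failChain (hK : IsStochastic K) (hp : ∀ i, p i ∈ Ioo (0 : ℝ) 1) :
    IsStochastic (failChain K p) := by
  refine ⟨fun i j => ?_, fun i => ?_⟩
  · have := failChain_mulVec_nonneg hK hp (v := Pi.single j 1)
      (fun l => by by_cases h : l = j <;> simp [h]) i
    simpa using this
  · simpa [Matrix.mulVec, dotProduct] using congrFun (failChain_mulVec_one hK hp) i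

lemma meanSucc_nonneg (hK : IsStochastic K) (hp : ∀ i, p i ∈ Ioo (0 : ℝ) 1) (m : ℕ) (i : n) :
    0 ≤ meanSucc K p m i := by
  induction m generalizing i with
  | zero => simp [meanSucc]
  | succ m ih =>
    refine nonneg_of_succMat_mulVec_nonneg hK hp (fun j => ?_) i
    rw [meanSucc, succMat_mulVec_inv hK hp, Pi.add_apply, failMat_mulVec_apply]
    have := hK.mulVec_nonneg ih j
    have := hp j
    exact add_nonneg this.1.le (mul_nonneg (by linarith [this.2]) ‹_›)

lemma meanSucc_succ_apply (hK : IsStochastic K) (hp : ∀ i, p i ∈ Ioo (0 : ℝ) 1) (m : ℕ) (i : n) :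
    meanSucc K p (m + 1) i =
      p i + p i * (K *ᵥ meanSucc K p (m + 1)) i + (1 - p i) * (K *ᵥ meanSucc K p m) i := by
  have h := congrFun (succMat_mulVec_inv hK hp (p + failMat K p *ᵥ meanSucc K p m)) i
  rw [← meanSucc, succMat_mulVec_apply, Pi.add_apply, failMat_mulVec_apply] at h
  linarith

/-- Doeblin's condition for the chain observed at failure times. -/
lemma exists_failChain_pos (hK : IsStochastic K) (hμ : HasUniqueStationaryDist K μ)
    (hp : ∀ i, p i ∈ Ioo (0 : ℝ) 1) : ∃ j, ∀ i, 0 < failChain K p i j := by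
  obtain ⟨⟨⟨hμ0, hμ1⟩, hμK⟩, huniq⟩ := hμ
  obtain ⟨j, hj⟩ : ∃ j, μ j ≠ 0 := by
    by_contra! h
    simp [h] at hμ1
  refine ⟨j, fun i₀ => ?_⟩
  by_contra hcon
  have hQ := isStochastic_failChain hK hp
  set h : n → ℝ := failChain K p *ᵥ Pi.single j 1 with hh
  have hhQ : ∀ i, h i = failChain K p i j := fun i => by simp [hh]
  have hh0 : ∀ i, 0 ≤ h i := fun i => by rw [hhQ]; exact hQ.1 i j
  have key : ∀ i, h i = 0 → (K *ᵥ h) i = 0 ∧ K i j = 0 := by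
    intro i hi
    have h1 := congrFun (succMat_mulVec_failChain hK hp (Pi.single j 1)) i
    rw [← hh, succMat_mulVec_apply, failMat_mulVec_apply, hi] at h1
    have h2 := hK.mulVec_nonneg hh0 i
    have h3 : (K *ᵥ Pi.single j 1) i = K i j := by simp
    rw [h3] at h1
    have h4 := hK.1 i j
    obtain ⟨hp0, hp1⟩ := hp i
    have h5 : 0 ≤ p i * (K *ᵥ h) i := mul_nonneg hp0.le h2
    have h6 : 0 ≤ (1 - p i) * K i j := mul_nonneg (by linarith) h4
    constructor
    · have : p i * (K *ᵥ h) i = 0 := by linarith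
      exact (mul_eq_zero.1 this).resolve_left hp0.ne'
    · have : (1 - p i) * K i j = 0 := by linarith
      exact (mul_eq_zero.1 this).resolve_left (by linarith)
  obtain ⟨ν, hν, hνS⟩ := hK.exists_isStationaryDist_of_closed
    (S := Finset.univ.filter fun i => h i = 0)
    ⟨i₀, by simpa [hhQ] using le_antisymm (not_lt.1 hcon) (hQ.1 i₀ j)⟩ (by
      intro i hi l hl
      simp only [Finset.mem_filter, Finset.mem_univ, true_and] at hi hl
      have h1 := (Finset.sum_eq_zero_iff_of_nonneg
        (fun l _ => mul_nonneg (hK.1 i l) (hh0 l))).1 (key i hi).1 l (Finset.mem_univ l)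
      exact (mul_eq_zero.1 h1).resolve_right hl)
  rw [huniq ν hν] at hνS
  refine hj ?_
  rw [← hμK]
  refine Finset.sum_eq_zero fun i _ => ?_
  change μ i * K i j = 0
  by_cases hi : h i = 0
  · rw [(key i hi).2, mul_zero]
  · rw [hνS i (by simpa using hi), zero_mul]

lemma sum_abs_vecMul_le_of_doeblin {Q : Matrix n n ℝ} (hQ : IsStochastic Q) {j : n} {δ : ℝ}
    (hδ : ∀ i, δ ≤ Q i j) {v : n → ℝ} (hv : ∑ i, v i = 0) :
    ∑ l, |(v ᵥ* Q) l| ≤ (1 - δ) * ∑ i, |v i| := by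
  have h1 : ∀ l, (v ᵥ* Q) l = ∑ i, v i * (Q i l - if l = j then δ else 0) := by
    intro l
    simp [mul_sub, Finset.sum_sub_distrib, ← Finset.sum_mul, hv, Matrix.vecMul, dotProduct]
  have h2 : ∀ i l, 0 ≤ Q i l - if l = j then δ else 0 := by
    intro i l
    split_ifs with h
    · subst h; linarith [hδ i]
    · linarith [hQ.1 i l]
  calc ∑ l, |(v ᵥ* Q) l| ≤ ∑ l, ∑ i, |v i| * (Q i l - if l = j then δ else 0) := by
        refine Finset.sum_le_sum fun l _ => ?_
        rw [h1]
        refine (Finset.abs_sum_le_sum_abs _ _).trans (le_of_eq ?_)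
        refine Finset.sum_congr rfl fun i _ => ?_
        rw [abs_mul, abs_of_nonneg (h2 i l)]
    _ = (1 - δ) * ∑ i, |v i| := by
        rw [Finset.sum_comm, Finset.mul_sum]
        refine Finset.sum_congr rfl fun i _ => ?_
        rw [← Finset.mul_sum, Finset.sum_sub_distrib, hQ.2]
        simp [mul_comm]

lemma abs_dotProduct_pow_mulVec_le {Q : Matrix n n ℝ} (hQ : IsStochastic Q) {j : n} {δ : ℝ}
    (hδ : ∀ i, δ ≤ Q i j) {v : n → ℝ} (hv : ∑ i, v i = 0) (r : n → ℝ) (m : ℕ) :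
    |v ⬝ᵥ (Q ^ m *ᵥ r)| ≤ (1 - δ) ^ m * (∑ i, |v i|) * ∑ i, |r i| := by
  have hδ1 : 0 ≤ 1 - δ := by
    have h1 := hδ j
    have h2 : Q j j ≤ ∑ l, Q j l :=
      Finset.single_le_sum (fun l _ => hQ.1 j l) (Finset.mem_univ j)
    rw [hQ.2] at h2
    linarith
  induction m generalizing v with
  | zero =>
    simp only [pow_zero, Matrix.one_mulVec, one_mul, dotProduct]
    refine (Finset.abs_sum_le_sum_abs _ _).trans ?_
    rw [Finset.sum_mul]
    refine Finset.sum_le_sum fun i _ => ?_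
    rw [abs_mul]
    exact mul_le_mul_of_nonneg_left
      (Finset.single_le_sum (fun l _ => abs_nonneg (r l)) (Finset.mem_univ i)) (abs_nonneg _)
  | succ m ih =>
    rw [pow_succ', ← Matrix.mulVec_mulVec, Matrix.dotProduct_mulVec]
    refine (ih (by rw [hQ.sum_vecMul, hv])).trans ?_
    rw [pow_succ, mul_assoc ((1 - δ) ^ m) (1 - δ)]
    exact mul_le_mul_of_nonneg_right (mul_le_mul_of_nonneg_left
      (sum_abs_vecMul_le_of_doeblin hQ hδ hv) (pow_nonneg hδ1 m))
      (Finset.sum_nonneg fun i _ => abs_nonneg _)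

lemma failMat_eq_sub : failMat K p = K - Matrix.diagonal p * K := by
  ext i j
  simp [failMat, sub_mul]

lemma vecMul_failMat_eq (hμK : μ ᵥ* K = μ) : μ ᵥ* failMat K p = μ ᵥ* succMat K p := by
  rw [failMat_eq_sub, succMat, Matrix.vecMul_sub, Matrix.vecMul_sub, hμK, Matrix.vecMul_one]

lemma vecMul_failMat_failChain (hK : IsStochastic K) (hp : ∀ i, p i ∈ Ioo (0 : ℝ) 1)
    (hμK : μ ᵥ* K = μ) : (μ ᵥ* failMat K p) ᵥ* failChain K p = μ ᵥ* failMat K p := by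
  conv_lhs => rw [vecMul_failMat_eq hμK]
  rw [failChain, Matrix.vecMul_vecMul, ← Matrix.mul_assoc,
    Matrix.mul_nonsing_inv _ (isUnit_det_succMat hK hp), Matrix.one_mul]

lemma vecMul_failMat_dotProduct_pow (hK : IsStochastic K) (hp : ∀ i, p i ∈ Ioo (0 : ℝ) 1)
    (hμK : μ ᵥ* K = μ) (v : n → ℝ) (m : ℕ) :
    (μ ᵥ* failMat K p) ⬝ᵥ (failChain K p ^ m *ᵥ v) = (μ ᵥ* failMat K p) ⬝ᵥ v := by
  induction m with
  | zero => simp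
  | succ m ih =>
    rw [pow_succ', ← Matrix.mulVec_mulVec, Matrix.dotProduct_mulVec,
      vecMul_failMat_failChain hK hp hμK, ih]

lemma sum_vecMul_failMat (hK : IsStochastic K) (hμ : IsProbVec μ) :
    ∑ i, (μ ᵥ* failMat K p) i = 1 - ∑ i, μ i * p i := by
  have h : (μ ᵥ* failMat K p) ⬝ᵥ 1 = μ ⬝ᵥ (failMat K p *ᵥ 1) := by
    rw [Matrix.dotProduct_mulVec]
  rw [dotProduct_one] at h
  rw [h, dotProduct]
  simp [failMat_mulVec_apply, hK.mulVec_one, mul_sub, Finset.sum_sub_distrib, hμ.2]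

/-- Geometric decay of `Q ^ m r`, where `Q` is the chain observed at failure times and `r` has
mean zero under its stationary distribution. -/
lemma exists_abs_dotProduct_failChain_pow_le (hK : IsStochastic K)
    (hμ : HasUniqueStationaryDist K μ) (hp : ∀ i, p i ∈ Ioo (0 : ℝ) 1) {r : n → ℝ}
    (hr : (μ ᵥ* failMat K p) ⬝ᵥ r = 0) :
    ∃ C c : ℝ, 0 < C ∧ 0 < c ∧ ∀ (m : ℕ) (η : n → ℝ), IsProbVec η →
      |η ⬝ᵥ (failChain K p ^ m *ᵥ r)| ≤ C * Real.exp (-c * m) := by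
  obtain ⟨j, hj⟩ := exists_failChain_pos hK hμ hp
  have hQ := isStochastic_failChain hK hp
  obtain ⟨i₀, -, hi₀⟩ := Finset.exists_min_image Finset.univ (fun i => failChain K p i j)
    ⟨j, Finset.mem_univ j⟩
  set δ := failChain K p i₀ j with hδ
  have hδ1 : 0 ≤ 1 - δ := by
    have h2 : δ ≤ ∑ l, failChain K p i₀ l :=
      Finset.single_le_sum (fun l _ => hQ.1 i₀ l) (Finset.mem_univ j)
    rw [hQ.2] at h2
    linarith
  set s := 1 - ∑ i, μ i * p i with hs
  have hs0 : 0 < s := by linarith [sum_mul_lt_one hμ.1.1 hp]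
  set w := μ ᵥ* failMat K p with hw
  have hw0 : ∀ i, 0 ≤ w i := fun i => Finset.sum_nonneg fun l _ => by
    refine mul_nonneg (hμ.1.1.1 l) ?_
    change 0 ≤ failMat K p l i
    rw [failMat, Matrix.diagonal_mul]
    exact mul_nonneg (by linarith [(hp l).2]) (hK.1 l i)
  have hws : ∑ i, w i = s := sum_vecMul_failMat hK hμ.1.1
  refine ⟨2 * (∑ i, |r i|) + 1, δ, by positivity, hj i₀, fun m η hη => ?_⟩
  have h0 : η ⬝ᵥ (failChain K p ^ m *ᵥ r) =
      (η - s⁻¹ • w) ⬝ᵥ (failChain K p ^ m *ᵥ r) := by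
    rw [sub_dotProduct, smul_dotProduct, vecMul_failMat_dotProduct_pow hK hp hμ.1.2, hr]
    simp
  have h1 : ∑ i, (η - s⁻¹ • w) i = 0 := by
    simp [Finset.sum_sub_distrib, ← Finset.mul_sum, hws, hη.2, hs0.ne']
  have h2 : ∑ i, |(η - s⁻¹ • w) i| ≤ 2 := by
    calc ∑ i, |(η - s⁻¹ • w) i| ≤ ∑ i, (η i + s⁻¹ * w i) := by
          refine Finset.sum_le_sum fun i _ => ?_
          have := hη.1 i
          have := mul_nonneg (inv_nonneg.2 hs0.le) (hw0 i)
          rw [Pi.sub_apply, Pi.smul_apply, smul_eq_mul, abs_le]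
          constructor <;> linarith
      _ = 2 := by
          rw [Finset.sum_add_distrib, ← Finset.mul_sum, hws, hη.2, inv_mul_cancel₀ hs0.ne']
          norm_num
  have h3 : (1 - δ) ^ m ≤ Real.exp (-δ * m) := by
    rw [mul_comm (-δ), Real.exp_nat_mul]
    exact pow_le_pow_left₀ hδ1 (by linarith [Real.add_one_le_exp (-δ)]) m
  have hR : 0 ≤ ∑ i, |r i| := Finset.sum_nonneg fun i _ => abs_nonneg _
  rw [h0]
  calc |(η - s⁻¹ • w) ⬝ᵥ (failChain K p ^ m *ᵥ r)|
      ≤ (1 - δ) ^ m * (∑ i, |(η - s⁻¹ • w) i|) * ∑ i, |r i| :=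
        abs_dotProduct_pow_mulVec_le hQ (fun i => hi₀ i (Finset.mem_univ i)) h1 r m
    _ ≤ Real.exp (-δ * m) * 2 * ∑ i, |r i| := by gcongr
    _ ≤ (2 * (∑ i, |r i|) + 1) * Real.exp (-δ * m) := by
        nlinarith [Real.exp_pos (-δ * m)]

lemma meanSucc_eq (hK : IsStochastic K) (hp : ∀ i, p i ∈ Ioo (0 : ℝ) 1) {a : ℝ} {r : n → ℝ}
    (hr : ∀ i, r i - (K *ᵥ r) i = p i - a * (1 - p i)) (m : ℕ) :
    meanSucc K p m = (a * m) • 1 + r - failChain K p ^ m *ᵥ r := by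
  induction m with
  | zero => simp [meanSucc]
  | succ m ih =>
    rw [meanSucc, ih]
    refine Eq.trans (congrArg _ ?_) (inv_mulVec_succMat hK hp _)
    rw [pow_succ', ← Matrix.mulVec_mulVec, Matrix.mulVec_sub _ _ (failChain K p *ᵥ _),
      succMat_mulVec_failChain hK hp]
    ext i
    simp only [Pi.add_apply, Pi.sub_apply, failMat_mulVec_apply, succMat_mulVec_apply,
      Matrix.mulVec_sub, Matrix.mulVec_add, Matrix.mulVec_smul, hK.mulVec_one, Pi.smul_apply,
      Pi.one_apply, smul_eq_mul, Nat.cast_add, Nat.cast_one]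
    linarith [hr i]

lemma centering_mulVec_apply (u : n → ℝ) (i : n) :
    ((1 - K + (1 / (1 - ∑ i, μ i * p i)) •
      Matrix.vecMulVec (fun i => 1 - p i) (μ ᵥ* failMat K p)) *ᵥ u) i =
      u i - (K *ᵥ u) i +
        ((μ ᵥ* failMat K p) ⬝ᵥ u) / (1 - ∑ i, μ i * p i) * (1 - p i) := by
  simp only [Matrix.add_mulVec, Matrix.sub_mulVec, Matrix.smul_mulVec, Matrix.one_mulVec,
    Matrix.vecMulVec_mulVec, Pi.add_apply, Pi.sub_apply, Pi.smul_apply, smul_eq_mul]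
  simp
  ring

lemma dotProduct_centering_mulVec (hμ : IsStationaryDist K μ)
    (hp : ∀ i, p i ∈ Ioo (0 : ℝ) 1) (u : n → ℝ) :
    μ ⬝ᵥ ((1 - K + (1 / (1 - ∑ i, μ i * p i)) •
      Matrix.vecMulVec (fun i => 1 - p i) (μ ᵥ* failMat K p)) *ᵥ u) =
      (μ ᵥ* failMat K p) ⬝ᵥ u := by
  have hs := sum_mul_lt_one hμ.1 hp
  have h1 : μ ⬝ᵥ (K *ᵥ u) = μ ⬝ᵥ u := by rw [Matrix.dotProduct_mulVec, hμ.2]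
  have h2 : ∑ i, μ i * (1 - p i) = 1 - ∑ i, μ i * p i := by
    simp [mul_sub, Finset.sum_sub_distrib, hμ.1.2]
  rw [dotProduct]
  simp only [centering_mulVec_apply, mul_add, mul_sub, Finset.sum_add_distrib,
    Finset.sum_sub_distrib]
  simp only [dotProduct] at h1
  rw [h1, sub_self, zero_add, ← Finset.sum_sub_distrib]
  simp only [← mul_sub, mul_left_comm (μ _)]
  rw [← Finset.mul_sum, h2, div_mul_cancel₀ _ (by linarith)]

lemma isUnit_det_centering (hK : IsStochastic K) (hμ : HasUniqueStationaryDist K μ)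
    (hp : ∀ i, p i ∈ Ioo (0 : ℝ) 1) :
    IsUnit (1 - K + (1 / (1 - ∑ i, μ i * p i)) •
      Matrix.vecMulVec (fun i => 1 - p i) (μ ᵥ* failMat K p)).det := by
  rw [isUnit_iff_ne_zero]
  intro h0
  obtain ⟨u, hu, hu0⟩ := Matrix.exists_mulVec_eq_zero_iff.2 h0
  have hw := dotProduct_centering_mulVec hμ.1 hp u
  rw [hu0, dotProduct_zero] at hw
  have hKu : K *ᵥ u = u := by
    ext i
    have h1 := congrFun hu0 i
    rw [centering_mulVec_apply, ← hw, Pi.zero_apply, zero_div, zero_mul, add_zero] at h1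
    linarith
  have hQu : failChain K p *ᵥ u = u := by
    rw [failChain_mulVec_eq_iff hK hp]
    ext i
    rw [failMat_mulVec_apply, succMat_mulVec_apply, hKu]
    ring
  have hQmu : ∀ m : ℕ, failChain K p ^ m *ᵥ u = u := by
    intro m
    induction m with
    | zero => simp
    | succ m ih => rw [pow_succ, ← Matrix.mulVec_mulVec, hQu, ih]
  obtain ⟨C, c, -, hc, hbound⟩ := exists_abs_dotProduct_failChain_pow_le hK hμ hp hw.symm
  refine hu (funext fun i => ?_)
  have hle : ∀ m : ℕ, |u i| ≤ C * Real.exp (-c * m) := fun m => by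
    have := hbound m (Pi.single i 1) ⟨fun l => by by_cases h : l = i <;> simp [h], by simp⟩
    rwa [hQmu, single_one_dotProduct] at this
  have hlim : Tendsto (fun m : ℕ => C * Real.exp (-c * m)) atTop (nhds (C * 0)) := by
    refine (Real.tendsto_exp_atBot.comp ?_).const_mul C
    exact tendsto_natCast_atTop_atTop.const_mul_atTop_of_neg (by linarith)
  rw [mul_zero] at hlim
  exact abs_eq_zero.1 (le_antisymm (ge_of_tendsto' hlim hle) (abs_nonneg _))

end FailureChain

lemma rvecGen_poisson {N : ℕ} {K : Matrix (Fin N) (Fin N) ℝ} {μ p : Fin N → ℝ}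
    (hK : IsStochastic K) (hμ : HasUniqueStationaryDist K μ) (hp : ∀ i, p i ∈ Ioo (0 : ℝ) 1) :
    (∀ i, rvecGen K μ p i - (K *ᵥ rvecGen K μ p) i =
      p i - (∑ i, μ i * p i) / (1 - ∑ i, μ i * p i) * (1 - p i)) ∧
    (μ ᵥ* failMat K p) ⬝ᵥ rvecGen K μ p = 0 := by
  set B := 1 - K + (1 / (1 - ∑ i, μ i * p i)) •
    Matrix.vecMulVec (fun i => 1 - p i) (μ ᵥ* failMat K p) with hB
  set a := (∑ i, μ i * p i) / (1 - ∑ i, μ i * p i) with ha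
  have hs : (1 - ∑ i, μ i * p i) ≠ 0 := by linarith [sum_mul_lt_one hμ.1.1 hp]
  have hr : rvecGen K μ p = B⁻¹ *ᵥ p - a • 1 := rfl
  have hu : B *ᵥ (B⁻¹ *ᵥ p) = p := by
    rw [Matrix.mulVec_mulVec, Matrix.mul_nonsing_inv _ (isUnit_det_centering hK hμ hp),
      Matrix.one_mulVec]
  set u := B⁻¹ *ᵥ p with hu_def
  have hw : (μ ᵥ* failMat K p) ⬝ᵥ u = ∑ i, μ i * p i := by
    rw [← dotProduct_centering_mulVec hμ.1 hp u, ← hB, hu, dotProduct]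
  rw [hr]
  constructor
  · intro i
    have h1 := congrFun hu i
    rw [hB, centering_mulVec_apply, hw] at h1
    rw [Matrix.mulVec_sub, Matrix.mulVec_smul, hK.mulVec_one]
    simp only [Pi.sub_apply]
    linarith
  · rw [dotProduct_sub, dotProduct_smul, hw, dotProduct_one, sum_vecMul_failMat hK hμ.1.1, ha,
      smul_eq_mul, div_mul_cancel₀ _ hs, sub_self]

/-! ### Counting successes and failures -/

/-- The number of failures among the first `J` tosses. -/
def failCount (x : ℕ → Bool) (J : ℕ) : ℕ := ((Finset.range J).filter fun j => x j = false).card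

/-- The number of successes among the first `J` tosses which precede the `m`-th failure. -/
def succCount (x : ℕ → Bool) (m J : ℕ) : ℕ :=
  ((Finset.range J).filter fun j => x j = true ∧ failCount x j < m).card

lemma failCount_succ (x : ℕ → Bool) (J : ℕ) :
    failCount x (J + 1) = failCount x J + if x J then 0 else 1 := by
  rw [failCount, failCount, Finset.card_filter, Finset.card_filter, Finset.sum_range_succ]
  cases x J <;> simp

lemma succCount_succ (x : ℕ → Bool) (m J : ℕ) :
    succCount x m (J + 1) =
      succCount x m J + if x J = true ∧ failCount x J < m then 1 else 0 := by
  rw [succCount, succCount, Finset.card_filter, Finset.card_filter, Finset.sum_range_succ]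

lemma failCount_le (x : ℕ → Bool) (J : ℕ) : failCount x J ≤ J :=
  (Finset.card_filter_le _ _).trans (Finset.card_range J).le

lemma succCount_le (x : ℕ → Bool) (m J : ℕ) : succCount x m J ≤ J :=
  (Finset.card_filter_le _ _).trans (Finset.card_range J).le

lemma failCount_mono (x : ℕ → Bool) : Monotone (failCount x) :=
  monotone_nat_of_le_succ fun J => by rw [failCount_succ]; omega

lemma succCount_mono (x : ℕ → Bool) (m : ℕ) : Monotone (succCount x m) :=
  monotone_nat_of_le_succ fun J => by rw [succCount_succ]; omega

lemma succCount_add_failCount {x : ℕ → Bool} {m J : ℕ} (h : ∀ j < J, failCount x j < m) :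
    succCount x m J + failCount x J = J := by
  induction J with
  | zero => rfl
  | succ J ih =>
    have h1 := ih fun j hj => h j (by omega)
    have h2 := h J (by omega)
    rw [succCount_succ, failCount_succ]
    cases x J <;> simp [h2] <;> omega

lemma succCount_eq_of_le {x : ℕ → Bool} {m t J : ℕ} (ht : m ≤ failCount x t) (hJ : t ≤ J) :
    succCount x m J = succCount x m t := by
  induction J, hJ using Nat.le_induction with
  | base => rfl
  | succ J hJ ih =>
    have := failCount_mono x hJ
    rw [succCount_succ, ih, if_neg (by omega), add_zero]

lemma numSucc_eq_succCount {x : ℕ → Bool} {m J : ℕ} (h : m ≤ failCount x J) :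
    numSucc x m = succCount x m J := by
  have hex : ∃ j, m ≤ failCount x j := ⟨J, h⟩
  obtain ⟨t, ht, hmin⟩ : ∃ t, m ≤ failCount x t ∧ ∀ j < t, failCount x j < m :=
    ⟨Nat.find hex, Nat.find_spec hex, fun j hj => not_le.1 (Nat.find_min hex hj)⟩
  have hfail : failCount x t = m := by
    refine le_antisymm ?_ ht
    cases t with
    | zero => simp [failCount]
    | succ t =>
      have := hmin t (by omega)
      rw [failCount_succ]
      split_ifs <;> omega
  have htJ : t ≤ J := by
    by_contra! hlt
    have := hmin J hlt
    omega
  have hadd := succCount_add_failCount hmin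
  rw [succCount_eq_of_le ht htJ]
  rw [hfail] at hadd
  have hmem : failCount x (succCount x m t + m) = m := by rw [hadd, hfail]
  refine le_antisymm (Nat.sInf_le hmem) (le_csInf ⟨_, hmem⟩ fun k hk => ?_)
  have hk' : failCount x (k + m) = m := hk
  have : t ≤ k + m := by
    by_contra! hlt
    have := hmin _ hlt
    omega
  omega

/-! ### One step of the cookie chain -/

lemma integral_comp_prod_eq {Ω α β : Type*} [MeasurableSpace Ω] [Fintype α] [Fintype β]
    [MeasurableSpace α] [MeasurableSpace β] [MeasurableSingletonClass α]
    [MeasurableSingletonClass β] {P : Measure Ω} [IsFiniteMeasure P] {Z : Ω → α} {V : Ω → β}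
    (hZ : Measurable Z) (hV : Measurable V) {k : α → β → ℝ}
    (h : ∀ z v, P.real {ω | Z ω = z ∧ V ω = v} = P.real {ω | Z ω = z} * k z v)
    (G : α → β → ℝ) : ∫ ω, G (Z ω) (V ω) ∂P = ∫ ω, ∑ v, k (Z ω) v * G (Z ω) v ∂P := by
  have h1 : ∫ ω, G (Z ω) (V ω) ∂P = ∫ x, G x.1 x.2 ∂(P.map fun ω => (Z ω, V ω)) :=
    (integral_map (hZ.prodMk hV).aemeasurable
      (Measurable.of_discrete (f := fun x : α × β => G x.1 x.2)).aestronglyMeasurable).symm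
  have h2 : ∫ ω, ∑ v, k (Z ω) v * G (Z ω) v ∂P = ∫ z, ∑ v, k z v * G z v ∂(P.map Z) :=
    (integral_map hZ.aemeasurable (Measurable.of_discrete
      (f := fun z : α => ∑ v, k z v * G z v)).aestronglyMeasurable).symm
  rw [h1, h2, integral_fintype (Integrable.of_finite), integral_fintype (Integrable.of_finite),
    Fintype.sum_prod_type]
  refine Finset.sum_congr rfl fun z _ => ?_
  rw [smul_eq_mul, Finset.mul_sum]
  refine Finset.sum_congr rfl fun v _ => ?_
  have e1 : (P.map fun ω => (Z ω, V ω)).real {(z, v)} = P.real {ω | Z ω = z ∧ V ω = v} := by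
    rw [map_measureReal_apply (hZ.prodMk hV) (measurableSet_singleton _)]
    congr 1
    ext ω
    simp
  have e2 : (P.map Z).real {z} = P.real {ω | Z ω = z} := by
    rw [map_measureReal_apply hZ (measurableSet_singleton _)]
    rfl
  rw [e1, e2, h, smul_eq_mul, mul_assoc]

lemma integrable_comp_of_mem_finset {Ω α : Type*} [MeasurableSpace Ω] [MeasurableSpace α]
    [DiscreteMeasurableSpace α] {P : Measure Ω} [IsFiniteMeasure P] {X : Ω → α}
    (hX : Measurable X) {S : Finset α} (hS : ∀ ω, X ω ∈ S) (f : α → ℝ) :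
    Integrable (fun ω => f (X ω)) P := by
  refine Integrable.of_bound
    ((Measurable.of_discrete (f := f)).comp hX).aestronglyMeasurable (∑ a ∈ S, |f a|)
    (Eventually.of_forall fun ω => ?_)
  exact Finset.single_le_sum (f := fun a => |f a|) (fun a _ => abs_nonneg _) (hS ω)

section CookieSite

variable {N : ℕ} {Ω : Type*} [MeasurableSpace Ω] {P : Measure Ω} {K : Matrix (Fin N) (Fin N) ℝ}
  {p η : Fin N → ℝ} {Rc : ℕ → Ω → Fin N} {ξ : ℕ → Ω → Bool}

lemma measurable_failCount (hξ : ∀ j, Measurable (ξ j)) (J : ℕ) :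
    Measurable fun ω => failCount (fun j => ξ j ω) J := by
  induction J with
  | zero => simp [failCount]
  | succ J ih =>
    simp only [failCount_succ]
    exact ih.add ((Measurable.of_discrete (f := fun b : Bool => if b then 0 else 1)).comp (hξ J))

lemma measurable_succCount (hξ : ∀ j, Measurable (ξ j)) (m J : ℕ) :
    Measurable fun ω => succCount (fun j => ξ j ω) m J := by
  induction J with
  | zero => simp [succCount]
  | succ J ih =>
    simp only [succCount_succ]
    exact ih.add ((Measurable.of_discrete
      (f := fun y : Bool × ℕ => if y.1 = true ∧ y.2 < m then 1 else 0)).comp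
        ((hξ J).prodMk (measurable_failCount hξ J)))

lemma IsCookieSite.measureReal_prefix [IsFiniteMeasure P] (h : IsCookieSite P K p η Rc ξ)
    (J : ℕ) (f : ℕ → Fin N) (b : ℕ → Bool) :
    P.real {ω | Rc J ω = f J ∧ ∀ j < J, Rc j ω = f j ∧ ξ j ω = b j} =
      η (f 0) * (∏ j ∈ Finset.range J, K (f j) (f (j + 1))) *
        ∏ j ∈ Finset.range J, (if b j then p (f j) else 1 - p (f j)) := by
  obtain ⟨hRc, hξ, hcyl⟩ := h
  set s := {ω | Rc J ω = f J ∧ ∀ j < J, Rc j ω = f j ∧ ξ j ω = b j} with hs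
  have hc : ∀ c : Bool, P.real (s ∩ {ω | ξ J ω = c}) =
      η (f 0) * (∏ j ∈ Finset.range J, K (f j) (f (j + 1))) *
        (∏ j ∈ Finset.range J, (if b j then p (f j) else 1 - p (f j))) *
          (if c then p (f J) else 1 - p (f J)) := by
    intro c
    have hset : s ∩ {ω | ξ J ω = c} =
        {ω | ∀ j ≤ J, Rc j ω = f j ∧ ξ j ω = Function.update b J c j} := by
      ext ω
      simp only [hs, mem_inter_iff, mem_ofPred_eq]
      constructor
      · rintro ⟨⟨h1, h2⟩, h3⟩ j hj
        rcases hj.lt_or_eq with hj | rfl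
        · rw [Function.update_of_ne hj.ne]
          exact h2 j hj
        · simpa using ⟨h1, h3⟩
      · intro h1
        refine ⟨⟨(h1 J le_rfl).1, fun j hj => ?_⟩, by simpa using (h1 J le_rfl).2⟩
        have := h1 j hj.le
        rwa [Function.update_of_ne hj.ne] at this
    rw [hset, measureReal_def, hcyl, Finset.prod_range_succ, Function.update_self, ← mul_assoc]
    congr 2
    refine Finset.prod_congr rfl fun j hj => ?_
    rw [Function.update_of_ne (Finset.mem_range.1 hj).ne]
  have hm : MeasurableSet {ω | ξ J ω = true} := hξ J (measurableSet_singleton true)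
  have hdiff : s \ {ω | ξ J ω = true} = s ∩ {ω | ξ J ω = false} := by
    ext ω
    simp
  rw [← measureReal_inter_add_sdiff (s := s) hm, hdiff, hc, hc]
  simp
  ring

lemma IsCookieSite.integral_zero [IsFiniteMeasure P] (h : IsCookieSite P K p η Rc ξ)
    (g : Fin N → ℝ) : ∫ ω, g (Rc 0 ω) ∂P = η ⬝ᵥ g := by
  have h1 : ∫ ω, g (Rc 0 ω) ∂P = ∫ i, g i ∂(P.map (Rc 0)) :=
    (integral_map (h.1 0).aemeasurable
      (Measurable.of_discrete (f := g)).aestronglyMeasurable).symm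
  rw [h1, integral_fintype (Integrable.of_finite), dotProduct]
  refine Finset.sum_congr rfl fun i _ => ?_
  have := h.measureReal_prefix 0 (fun _ => i) (fun _ => true)
  rw [map_measureReal_apply (h.1 0) (measurableSet_singleton _), smul_eq_mul]
  simp at this
  rw [← this]
  rfl

lemma IsCookieSite.integral_step [IsFiniteMeasure P] (h : IsCookieSite P K p η Rc ξ) (J : ℕ)
    (G : ℕ → Fin N → Bool → Fin N → ℝ) :
    ∫ ω, G (failCount (fun j => ξ j ω) J) (Rc J ω) (ξ J ω) (Rc (J + 1) ω) ∂P =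
      ∫ ω, ∑ l, K (Rc J ω) l *
        (p (Rc J ω) * G (failCount (fun j => ξ j ω) J) (Rc J ω) true l +
          (1 - p (Rc J ω)) * G (failCount (fun j => ξ j ω) J) (Rc J ω) false l) ∂P := by
  let Z : Ω → (Fin J → Fin N × Bool) × Fin N := fun ω => (fun j => (Rc j ω, ξ j ω), Rc J ω)
  let V : Ω → Bool × Fin N := fun ω => (ξ J ω, Rc (J + 1) ω)
  let F : (Fin J → Fin N × Bool) × Fin N → ℕ := fun z => ∑ j, if (z.1 j).2 = false then 1 else 0
  have hF : ∀ ω, failCount (fun j => ξ j ω) J = F (Z ω) := fun ω => by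
    rw [failCount, Finset.card_filter, Finset.sum_range]
  have hZ : Measurable Z := Measurable.prodMk (f := fun ω (j : Fin J) => (Rc j ω, ξ j ω))
    (measurable_pi_lambda _ fun j => (h.1 j).prodMk (h.2.1 j)) (h.1 J)
  have hV : Measurable V := (h.2.1 J).prodMk (h.1 (J + 1))
  have key := integral_comp_prod_eq (P := P) hZ hV
    (k := fun z v => (if v.1 then p z.2 else 1 - p z.2) * K z.2 v.2) (fun z v => by
      obtain ⟨y, l⟩ := z
      obtain ⟨c, l'⟩ := v
      let f : ℕ → Fin N := fun j => if hj : j < J then (y ⟨j, hj⟩).1 else if j = J then l else l'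
      let b : ℕ → Bool := fun j => if hj : j < J then (y ⟨j, hj⟩).2 else c
      have fJ : f J = l := by simp [f]
      have fJ1 : f (J + 1) = l' := by simp [f]
      have bJ : b J = c := by simp [b]
      have hpre : ∀ ω, (∀ j < J, Rc j ω = f j ∧ ξ j ω = b j) ↔
          (fun j : Fin J => (Rc j ω, ξ j ω)) = y := by
        intro ω
        rw [funext_iff]
        constructor
        · intro h1 j
          have := h1 j j.2
          simp only [f, b, j.2, dif_pos] at this
          exact Prod.ext this.1 this.2
        · intro h1 j hj
          have := h1 ⟨j, hj⟩
          simp only [f, b, hj, dif_pos, ← this, and_self]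
      have e1 : {ω | Z ω = (y, l)} =
          {ω | Rc J ω = f J ∧ ∀ j < J, Rc j ω = f j ∧ ξ j ω = b j} := by
        ext ω
        simp only [mem_ofPred_eq, hpre, fJ, Z, Prod.mk.injEq]
        tauto
      have e2 : {ω | Z ω = (y, l) ∧ V ω = (c, l')} =
          {ω | Rc (J + 1) ω = f (J + 1) ∧ ∀ j < J + 1, Rc j ω = f j ∧ ξ j ω = b j} := by
        ext ω
        simp only [mem_ofPred_eq, Nat.forall_lt_succ_right, hpre, fJ, fJ1, bJ, Z, V,
          Prod.mk.injEq]
        tauto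
      rw [e1, e2, h.measureReal_prefix, h.measureReal_prefix, Finset.prod_range_succ,
        Finset.prod_range_succ, fJ, fJ1, bJ]
      ring)
    (fun z v => G (F z) z.2 v.1 v.2)
  simp only [hF]
  refine key.trans (integral_congr_ae (Eventually.of_forall fun ω => ?_))
  dsimp only
  rw [Fintype.sum_prod_type, Fintype.sum_bool, ← Finset.sum_add_distrib]
  refine Finset.sum_congr rfl fun l _ => ?_
  simp only [if_true, Bool.false_eq_true, if_false, Z]
  ring

lemma IsCookieSite.integrable_step [IsFiniteMeasure P] (h : IsCookieSite P K p η Rc ξ) (J : ℕ)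
    (G : ℕ → Fin N → Bool → Fin N → ℝ) :
    Integrable
      (fun ω => G (failCount (fun j => ξ j ω) J) (Rc J ω) (ξ J ω) (Rc (J + 1) ω)) P :=
  integrable_comp_of_mem_finset
    (X := fun ω => (failCount (fun j => ξ j ω) J, Rc J ω, ξ J ω, Rc (J + 1) ω))
    ((measurable_failCount h.2.1 J).prodMk
      ((h.1 J).prodMk ((h.2.1 J).prodMk (h.1 (J + 1)))))
    (S := Finset.range (J + 1) ×ˢ Finset.univ)
    (fun ω => by simpa using Nat.lt_succ_of_le (failCount_le _ _))
    (fun y => G y.1 y.2.1 y.2.2.1 y.2.2.2)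

lemma integrable_succCount [IsFiniteMeasure P] (hξ : ∀ j, Measurable (ξ j)) (m J : ℕ) :
    Integrable (fun ω => (succCount (fun j => ξ j ω) m J : ℝ)) P :=
  integrable_comp_of_mem_finset (measurable_succCount hξ m J) (S := Finset.range (J + 1))
    (fun ω => by simpa using Nat.lt_succ_of_le (succCount_le _ _ _)) fun a : ℕ => (a : ℝ)

lemma integral_failCount_lt (hξ : ∀ j, Measurable (ξ j)) (m J : ℕ) :
    ∫ ω, (if failCount (fun j => ξ j ω) J < m then (1 : ℝ) else 0) ∂P =
      P.real {ω | failCount (fun j => ξ j ω) J < m} := by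
  have hmeas : MeasurableSet {ω | failCount (fun j => ξ j ω) J < m} :=
    measurable_failCount hξ J (MeasurableSet.of_discrete (s := Set.Iio m))
  rw [← integral_indicator_one hmeas]
  refine integral_congr_ae (Eventually.of_forall fun ω => ?_)
  simp [Set.indicator_apply]

/-- The successes collected up to time `J`, plus the mean number of successes still to come,
have constant expectation. -/
lemma IsCookieSite.integral_succCount_add [IsFiniteMeasure P] (h : IsCookieSite P K p η Rc ξ)
    (hK : IsStochastic K) (hp : ∀ i, p i ∈ Ioo (0 : ℝ) 1) (m J : ℕ) :
    ∫ ω, (succCount (fun j => ξ j ω) m J : ℝ) ∂P +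
      ∫ ω, meanSucc K p (m - failCount (fun j => ξ j ω) J) (Rc J ω) ∂P =
        η ⬝ᵥ meanSucc K p m := by
  induction J with
  | zero => simpa [succCount, failCount] using h.integral_zero (meanSucc K p m)
  | succ J ih =>
    rw [← ih, ← sub_eq_zero]
    have hzero : ∀ k i, ∑ l, K i l *
        (p i * ((if true = true ∧ k < m then 1 else 0) +
          meanSucc K p (m - (k + if true then 0 else 1)) l - meanSucc K p (m - k) i) +
        (1 - p i) * ((if false = true ∧ k < m then 1 else 0) +
          meanSucc K p (m - (k + if false then 0 else 1)) l - meanSucc K p (m - k) i)) = 0 := by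
      intro k i
      by_cases hk : k < m
      · obtain ⟨d, rfl⟩ := Nat.exists_eq_add_of_lt hk
        have e1 : k + d + 1 - k = d + 1 := by omega
        have e2 : k + d + 1 - (k + 1) = d := by omega
        have hm := meanSucc_succ_apply hK hp d i
        simp only [hk, if_true, and_self, add_zero, e1, e2, Bool.false_eq_true, false_and,
          if_false]
        calc _ = ∑ l, (p i * K i l + p i * (K i l * meanSucc K p (d + 1) l) +
              (1 - p i) * (K i l * meanSucc K p d l) - meanSucc K p (d + 1) i * K i l) :=
              Finset.sum_congr rfl fun l _ => by ring
          _ = 0 := by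
              simp only [Finset.sum_add_distrib, Finset.sum_sub_distrib, ← Finset.mul_sum, hK.2]
              simp only [Matrix.mulVec, dotProduct] at hm
              linarith
      · have e1 : m - k = 0 := by omega
        have e2 : m - (k + 1) = 0 := by omega
        simp [hk, e1, e2, meanSucc]
    have hstep := (h.integral_step J fun k l b l' =>
      (if b = true ∧ k < m then 1 else 0) +
        meanSucc K p (m - (k + if b then 0 else 1)) l' - meanSucc K p (m - k) l).trans
      (integral_eq_zero_of_ae (Eventually.of_forall fun ω => hzero _ _))
    have hi1 := integrable_succCount (P := P) h.2.1 m J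
    have hi2 := integrable_succCount (P := P) h.2.1 m (J + 1)
    have hi3 := h.integrable_step J fun k l _ _ => meanSucc K p (m - k) l
    have hi4 := h.integrable_step (J + 1) fun k l _ _ => meanSucc K p (m - k) l
    rw [← integral_add hi2 hi4, ← integral_add hi1 hi3,
      ← integral_sub (by exact hi2.add hi4) (by exact hi1.add hi3), ← hstep]
    refine integral_congr_ae (Eventually.of_forall fun ω => ?_)
    simp only [succCount_succ, failCount_succ]
    push_cast
    ring

lemma IsCookieSite.tendsto_measureReal_failCount_lt [IsFiniteMeasure P]
    (h : IsCookieSite P K p η Rc ξ) (hK : IsStochastic K) (hp : ∀ i, p i ∈ Ioo (0 : ℝ) 1)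
    (m : ℕ) :
    Tendsto (fun J => P.real {ω | failCount (fun j => ξ j ω) J < m}) atTop (nhds 0) := by
  rcases isEmpty_or_nonempty (Fin N) with hN | hN
  · have : IsEmpty Ω := ⟨fun ω => hN.false (Rc 0 ω)⟩
    simp [Set.eq_empty_of_isEmpty]
  obtain ⟨i₀, -, hi₀⟩ := Finset.exists_min_image Finset.univ p Finset.univ_nonempty
  have hp0 : 0 < p i₀ := (hp i₀).1
  have hstep : ∀ J, p i₀ * P.real {ω | failCount (fun j => ξ j ω) J < m} ≤
      ∫ ω, (succCount (fun j => ξ j ω) m (J + 1) : ℝ) ∂P -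
        ∫ ω, (succCount (fun j => ξ j ω) m J : ℝ) ∂P := by
    intro J
    have h1 := h.integral_step J fun k _ b _ => if b = true ∧ k < m then 1 else 0
    rw [← integral_sub (integrable_succCount h.2.1 m (J + 1)) (integrable_succCount h.2.1 m J)]
    calc p i₀ * P.real {ω | failCount (fun j => ξ j ω) J < m}
        = ∫ ω, p i₀ * (if failCount (fun j => ξ j ω) J < m then 1 else 0) ∂P := by
          rw [integral_const_mul, integral_failCount_lt h.2.1]
      _ ≤ ∫ ω, p (Rc J ω) * (if failCount (fun j => ξ j ω) J < m then 1 else 0) ∂P := by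
          refine integral_mono
            (h.integrable_step J fun k _ _ _ => p i₀ * (if k < m then 1 else 0))
            (h.integrable_step J fun k l _ _ => p l * (if k < m then 1 else 0)) fun ω => ?_
          exact mul_le_mul_of_nonneg_right (hi₀ _ (Finset.mem_univ _)) (by positivity)
      _ = _ := by
          have h2 : ∀ ω, ((succCount (fun j => ξ j ω) m (J + 1) : ℝ) -
              succCount (fun j => ξ j ω) m J) =
              if ξ J ω = true ∧ failCount (fun j => ξ j ω) J < m then 1 else 0 := fun ω => by
            rw [succCount_succ]
            push_cast
            ring
          simp only [h2]
          rw [h1]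
          refine integral_congr_ae (Eventually.of_forall fun ω => ?_)
          dsimp only
          rw [← Finset.sum_mul, hK.2]
          simp
  have hbound : ∀ J, ∫ ω, (succCount (fun j => ξ j ω) m J : ℝ) ∂P ≤ η ⬝ᵥ meanSucc K p m := by
    intro J
    rw [← h.integral_succCount_add hK hp m J]
    exact le_add_of_nonneg_right (integral_nonneg fun ω => meanSucc_nonneg hK hp _ _)
  have hsum : Summable fun J => p i₀ * P.real {ω | failCount (fun j => ξ j ω) J < m} := by
    refine summable_of_sum_range_le (c := η ⬝ᵥ meanSucc K p m)
      (fun J => mul_nonneg hp0.le measureReal_nonneg) fun J => ?_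
    refine (Finset.sum_le_sum fun j _ => hstep j).trans ?_
    rw [Finset.sum_range_sub fun j => ∫ ω, (succCount (fun i => ξ i ω) m j : ℝ) ∂P]
    have : ∫ ω, (succCount (fun i => ξ i ω) m 0 : ℝ) ∂P = 0 := by simp [succCount]
    rw [this, sub_zero]
    exact hbound J
  simpa [hp0.ne'] using hsum.tendsto_atTop_zero.const_mul (p i₀)⁻¹

lemma IsCookieSite.tendsto_integral_succCount [IsFiniteMeasure P]
    (h : IsCookieSite P K p η Rc ξ) (hK : IsStochastic K) (hp : ∀ i, p i ∈ Ioo (0 : ℝ) 1)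
    (m : ℕ) :
    Tendsto (fun J => ∫ ω, (succCount (fun j => ξ j ω) m J : ℝ) ∂P) atTop
      (nhds (η ⬝ᵥ meanSucc K p m)) := by
  set B := ∑ k ∈ Finset.range (m + 1), ∑ i, meanSucc K p k i with hB
  have hle : ∀ k ≤ m, ∀ i, meanSucc K p k i ≤ B := fun k hk i =>
    (Finset.single_le_sum (f := fun i => meanSucc K p k i)
      (fun i _ => meanSucc_nonneg hK hp k i) (Finset.mem_univ i)).trans
    (Finset.single_le_sum (f := fun k => ∑ i, meanSucc K p k i)
      (fun k _ => Finset.sum_nonneg fun i _ => meanSucc_nonneg hK hp k i)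
      (Finset.mem_range.2 (by omega)))
  have hrest : Tendsto
      (fun J => ∫ ω, meanSucc K p (m - failCount (fun j => ξ j ω) J) (Rc J ω) ∂P) atTop
      (nhds 0) := by
    have hlim := (h.tendsto_measureReal_failCount_lt hK hp m).const_mul B
    rw [mul_zero] at hlim
    refine squeeze_zero (fun J => integral_nonneg fun ω => meanSucc_nonneg hK hp _ _)
      (fun J => ?_) hlim
    calc ∫ ω, meanSucc K p (m - failCount (fun j => ξ j ω) J) (Rc J ω) ∂P
        ≤ ∫ ω, B * (if failCount (fun j => ξ j ω) J < m then 1 else 0) ∂P := by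
          refine integral_mono (h.integrable_step J fun k l _ _ => meanSucc K p (m - k) l)
            (h.integrable_step J fun k _ _ _ => B * (if k < m then 1 else 0)) fun ω => ?_
          dsimp only
          split_ifs with hlt
          · rw [mul_one]
            exact hle _ (Nat.sub_le _ _) _
          · rw [Nat.sub_eq_zero_of_le (not_lt.1 hlt)]
            simp [meanSucc]
      _ = B * P.real {ω | failCount (fun j => ξ j ω) J < m} := by
          rw [integral_const_mul, integral_failCount_lt h.2.1]
  have := (tendsto_const_nhds (x := η ⬝ᵥ meanSucc K p m)).sub hrest
  rw [sub_zero] at this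
  refine this.congr fun J => ?_
  rw [← h.integral_succCount_add hK hp m J, add_sub_cancel_right]

lemma IsCookieSite.integral_numSucc [IsFiniteMeasure P] (h : IsCookieSite P K p η Rc ξ)
    (hK : IsStochastic K) (hp : ∀ i, p i ∈ Ioo (0 : ℝ) 1) (m : ℕ) :
    ∫ ω, (numSucc (fun j => ξ j ω) m : ℝ) ∂P = η ⬝ᵥ meanSucc K p m := by
  have hnull : P.real (⋂ J, {ω | failCount (fun j => ξ j ω) J < m}) ≤ 0 :=
    ge_of_tendsto' (h.tendsto_measureReal_failCount_lt hK hp m) fun J =>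
      measureReal_mono (iInter_subset _ J)
  have hae : ∀ᵐ ω ∂P, ∃ J, m ≤ failCount (fun j => ξ j ω) J := by
    rw [ae_iff]
    have h0 := (measureReal_eq_zero_iff).1 (le_antisymm hnull measureReal_nonneg)
    convert h0 using 2
    ext ω
    simp
  have hlim : ∀ᵐ ω ∂P, Tendsto (fun J => (succCount (fun j => ξ j ω) m J : ℝ)) atTop
      (nhds (numSucc (fun j => ξ j ω) m : ℝ)) := by
    filter_upwards [hae] with ω hω
    obtain ⟨J₀, hJ₀⟩ := hω
    refine tendsto_const_nhds.congr' ?_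
    filter_upwards [eventually_ge_atTop J₀] with J hJ
    rw [numSucc_eq_succCount (hJ₀.trans (failCount_mono _ hJ))]
  have hint := fun J => integrable_succCount (P := P) h.2.1 m J
  have hlint := lintegral_tendsto_of_tendsto_of_monotone (μ := P)
    (f := fun J ω => ENNReal.ofReal (succCount (fun j => ξ j ω) m J : ℝ))
    (F := fun ω => ENNReal.ofReal (numSucc (fun j => ξ j ω) m : ℝ))
    (fun J => (hint J).aestronglyMeasurable.aemeasurable.ennreal_ofReal)
    (Eventually.of_forall fun ω J J' hJ =>
      ENNReal.ofReal_le_ofReal (Nat.cast_le.2 (succCount_mono _ m hJ)))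
    (hlim.mono fun ω hω => (ENNReal.continuous_ofReal.tendsto _).comp hω)
  have heq : ∀ J, ∫⁻ ω, ENNReal.ofReal (succCount (fun j => ξ j ω) m J : ℝ) ∂P =
      ENNReal.ofReal (∫ ω, (succCount (fun j => ξ j ω) m J : ℝ) ∂P) := fun J =>
    (ofReal_integral_eq_lintegral_ofReal (hint J)
      (Eventually.of_forall fun ω => Nat.cast_nonneg _)).symm
  simp only [heq] at hlint
  have hT := h.tendsto_integral_succCount hK hp m
  have huniq := tendsto_nhds_unique hlint ((ENNReal.continuous_ofReal.tendsto _).comp hT)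
  rw [integral_eq_lintegral_of_nonneg_ae (Eventually.of_forall fun ω => Nat.cast_nonneg _)
    (aestronglyMeasurable_of_tendsto_ae atTop (fun J => (hint J).aestronglyMeasurable) hlim),
    huniq, ENNReal.toReal_ofReal]
  exact ge_of_tendsto' hT fun J => integral_nonneg fun ω => Nat.cast_nonneg _

end CookieSite

/-- **Proposition 3.1 (mean of the forward BLP).** For every initial distribution `η`,
`E_η^{U,n}[U₁]/n → λ = p̄/(1−p̄)`, and there are constants `C, c > 0`, uniform in `η`,
with `|E_η^{U,n}[U₁] − λn − η·𝐫| ≤ C e^{−cn}` for all `n`. Here `U₁ = S_n` is the number of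
successes before the `n`-th failure at a site, and `Pfam η` is the averaged law of the site
environment with initial distribution `η`. -/
theorem forward_BLP_mean_asymptotics
    {N : ℕ} {Ω : Type*} [MeasurableSpace Ω]
    (K : Matrix (Fin N) (Fin N) ℝ) (μ p : Fin N → ℝ)
    (Rc : ℕ → Ω → Fin N) (ξ : ℕ → Ω → Bool)
    (Pfam : (Fin N → ℝ) → Measure Ω)
    (hK : IsStochastic K) (hμ : HasUniqueStationaryDist K μ)
    (hp : ∀ i, p i ∈ Set.Ioo (0 : ℝ) 1)
    (henv : ∀ η : Fin N → ℝ, IsProbVec η →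
      IsProbabilityMeasure (Pfam η) ∧ IsCookieSite (Pfam η) K p η Rc ξ) :
    (∀ η : Fin N → ℝ, IsProbVec η →
      Tendsto (fun n : ℕ => (∫ ω, (numSucc (fun j => ξ j ω) n : ℝ) ∂Pfam η) / n) atTop
        (nhds ((∑ i, μ i * p i) / (1 - ∑ i, μ i * p i)))) ∧
    ∃ C c : ℝ, 0 < C ∧ 0 < c ∧
      ∀ (n : ℕ) (η : Fin N → ℝ), IsProbVec η →
        |(∫ ω, (numSucc (fun j => ξ j ω) n : ℝ) ∂Pfam η) -
            ((∑ i, μ i * p i) / (1 - ∑ i, μ i * p i)) * n -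
            ∑ i, η i * rvecGen K μ p i| ≤ C * Real.exp (-c * n) := by
  obtain ⟨hr, hwr⟩ := rvecGen_poisson hK hμ hp
  set r := rvecGen K μ p with hr_def
  set a := (∑ i, μ i * p i) / (1 - ∑ i, μ i * p i) with ha
  have hmean : ∀ (n : ℕ) (η : Fin N → ℝ), IsProbVec η →
      (∫ ω, (numSucc (fun j => ξ j ω) n : ℝ) ∂Pfam η) - a * n - ∑ i, η i * r i =
        -(η ⬝ᵥ (failChain K p ^ n *ᵥ r)) := by
    intro n η hη
    obtain ⟨_, hsite⟩ := henv η hη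
    rw [hsite.integral_numSucc hK hp, meanSucc_eq hK hp hr, dotProduct_sub, dotProduct_add,
      dotProduct_smul, dotProduct_one, hη.2, smul_eq_mul, mul_one]
    change a * n + ∑ i, η i * r i - _ - a * n - ∑ i, η i * r i = _
    ring
  obtain ⟨C, c, hC, hc, hbound⟩ := exists_abs_dotProduct_failChain_pow_le hK hμ hp hwr
  have herr : ∀ (n : ℕ) (η : Fin N → ℝ), IsProbVec η →
      |(∫ ω, (numSucc (fun j => ξ j ω) n : ℝ) ∂Pfam η) - a * n - ∑ i, η i * r i| ≤
        C * Real.exp (-c * n) := fun n η hη => by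
    rw [hmean n η hη, abs_neg]
    exact hbound n η hη
  refine ⟨fun η hη => ?_, C, c, hC, hc, herr⟩
  rw [tendsto_iff_norm_sub_tendsto_zero]
  refine squeeze_zero' (Eventually.of_forall fun n => norm_nonneg _) ?_
    (tendsto_const_div_atTop_nhds_zero_nat (C + |∑ i, η i * r i|))
  filter_upwards [eventually_gt_atTop 0] with n hn
  have hn' : (0 : ℝ) < n := Nat.cast_pos.2 hn
  rw [Real.norm_eq_abs, div_sub' hn'.ne', abs_div, abs_of_pos hn']
  refine div_le_div_of_nonneg_right ?_ hn'.le
  have hexp : Real.exp (-c * n) ≤ 1 := Real.exp_le_one_iff.2 (by nlinarith)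
  have h1 := herr n η hη
  have h2 : C * Real.exp (-c * n) ≤ C := mul_le_of_le_one_right hC.le hexp
  rw [mul_comm (n : ℝ) a]
  calc |(∫ ω, (numSucc (fun j => ξ j ω) n : ℝ) ∂Pfam η) - a * n|
      = |((∫ ω, (numSucc (fun j => ξ j ω) n : ℝ) ∂Pfam η) - a * n - ∑ i, η i * r i) +
          ∑ i, η i * r i| := by rw [sub_add_cancel]
    _ ≤ _ := (abs_add_le _ _).trans (by linarith)

end
end

section
/- There is a constant C > 0 such that for every n ≥ 1 and every distribution η on R, |Var_η(U_1 | U_0 = n)/n − ν| ≤ C/n, where ν = (1+λ)(λ + 2μD_pK𝐫) with λ = p̄/(1−p̄) and 𝐫 as in the mean asymptotics of the forward BLP. In particular, if p̄ = 1/2 then ν = 2 + 4μD_pK𝐫 = 4μD_pK(I − K + 2(𝟏−𝐩)μD_{1−p}K)^{−1}𝐩. -/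
open MeasureTheory Filter Set Matrix ProbabilityTheory
open scoped Classical

noncomputable section

section LinearAlgebra

variable {N : ℕ} {K : Matrix (Fin N) (Fin N) ℝ} {p μ : Fin N → ℝ}

lemma IsStochastic.mulVec_const (hK : IsStochastic K) (c : ℝ) (i : Fin N) :
    (K *ᵥ fun _ => c) i = c := by
  simp [Matrix.mulVec, dotProduct, ← Finset.sum_mul, hK.2 i]

lemma IsStochastic.mulVec_one_s11 (hK : IsStochastic K) (i : Fin N) : (K *ᵥ 1) i = 1 :=
  hK.mulVec_const 1 i

lemma IsStochastic.mulVec_mono (hK : IsStochastic K) {v w : Fin N → ℝ} (h : ∀ i, v i ≤ w i)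
    (i : Fin N) : (K *ᵥ v) i ≤ (K *ᵥ w) i := by
  simp only [Matrix.mulVec, dotProduct]
  exact Finset.sum_le_sum fun j _ => mul_le_mul_of_nonneg_left (h j) (hK.1 i j)

lemma IsStochastic.le_mulVec (hK : IsStochastic K) {v : Fin N → ℝ} {c : ℝ} (h : ∀ i, c ≤ v i)
    (i : Fin N) : c ≤ (K *ᵥ v) i := by
  simpa only [hK.mulVec_const] using hK.mulVec_mono (v := fun _ => c) h i

lemma IsStochastic.mulVec_le (hK : IsStochastic K) {v : Fin N → ℝ} {c : ℝ} (h : ∀ i, v i ≤ c)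
    (i : Fin N) : (K *ᵥ v) i ≤ c := by
  simpa only [hK.mulVec_const] using hK.mulVec_mono (w := fun _ => c) h i

/-- Minimum principle for the substochastic operator `D_p K`. -/
lemma IsStochastic.nonneg_of_le (hK : IsStochastic K) (hp : ∀ i, p i ∈ Set.Ioo (0 : ℝ) 1)
    {v : Fin N → ℝ} (h : ∀ i, p i * (K *ᵥ v) i ≤ v i) (i : Fin N) : 0 ≤ v i := by
  have : Nonempty (Fin N) := ⟨i⟩
  obtain ⟨k, hk⟩ := Finite.exists_min v
  have h1 := hK.le_mulVec hk k
  have h2 := h k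
  have h3 := mul_le_mul_of_nonneg_left h1 (hp k).1.le
  have h4 : 0 ≤ v k := by
    by_contra! h5
    nlinarith [(hp k).2]
  exact h4.trans (hk i)

lemma IsStochastic.exists_resolvent (hK : IsStochastic K) (hp : ∀ i, p i ∈ Set.Ioo (0 : ℝ) 1)
    (u : Fin N → ℝ) : ∃ v : Fin N → ℝ, ∀ i, v i - p i * (K *ᵥ v) i = u i := by
  let T : (Fin N → ℝ) →ₗ[ℝ] (Fin N → ℝ) :=
    { toFun := fun v i => v i - p i * (K *ᵥ v) i
      map_add' := fun v w => by ext i; simp [Matrix.mulVec_add]; ring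
      map_smul' := fun c v => by ext i; simp [Matrix.mulVec_smul]; ring }
  have hinj : Function.Injective T := by
    rw [injective_iff_map_eq_zero]
    intro v hv
    have hv' : ∀ i, v i - p i * (K *ᵥ v) i = 0 := fun i => congrFun hv i
    ext i
    refine le_antisymm ?_ (hK.nonneg_of_le hp (fun i => by linarith [hv' i]) i)
    have := hK.nonneg_of_le hp (v := -v)
      (fun i => by simp [Matrix.mulVec_neg]; linarith [hv' i]) i
    simpa using this
  obtain ⟨v, hv⟩ := LinearMap.injective_iff_surjective.1 hinj u
  exact ⟨v, fun i => congrFun hv i⟩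

/-- A nonempty closed set of states carries a stationary distribution. -/
lemma IsStochastic.exists_stationary_of_closed (hK : IsStochastic K) {Z : Set (Fin N)}
    (hne : Z.Nonempty) (hZ : ∀ i ∈ Z, ∀ j ∉ Z, K i j = 0) :
    ∃ w, IsStationaryDist K w ∧ ∀ i ∉ Z, w i = 0 := by
  let B : Matrix (Fin N) (Fin N) ℝ := Matrix.of fun i j =>
    (1 : Matrix (Fin N) (Fin N) ℝ) i j - if i ∈ Z then K i j else 0
  have hBv : ∀ v i, (B *ᵥ v) i = v i - ∑ j, (if i ∈ Z then K i j else 0) * v j := fun v i => by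
    simp only [B, Matrix.mulVec, dotProduct, Matrix.of_apply, sub_mul, Finset.sum_sub_distrib,
      Matrix.one_apply]
    simp
  have hB : ∃ v, v ≠ 0 ∧ B *ᵥ v = 0 := by
    refine ⟨fun i => if i ∈ Z then 1 else 0, ?_, ?_⟩
    · obtain ⟨i, hi⟩ := hne
      intro h
      simpa [hi] using congrFun h i
    · ext i
      rw [hBv]
      by_cases hi : i ∈ Z
      · have : ∑ j, K i j * (if j ∈ Z then (1 : ℝ) else 0) = 1 := by
          refine (Finset.sum_congr rfl fun j _ => ?_).trans (hK.2 i)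
          by_cases hj : j ∈ Z
          · simp [hj]
          · simp [hj, hZ i hi j hj]
        simp only [hi, if_true, this, sub_self, Pi.zero_apply]
      · simp [hi]
  obtain ⟨w, hw0, hw⟩ := Matrix.exists_vecMul_eq_zero_iff.2 (Matrix.exists_mulVec_eq_zero_iff.1 hB)
  have hw1 : ∀ j, w j = ∑ i, w i * (if i ∈ Z then K i j else 0) := fun j => by
    have := congrFun hw j
    simp only [B, Matrix.vecMul, dotProduct, Matrix.of_apply, mul_sub, Finset.sum_sub_distrib,
      Matrix.one_apply, Pi.zero_apply] at this
    simp at this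
    simp
    linarith
  have hwZ : ∀ j ∉ Z, w j = 0 := fun j hj => by
    rw [hw1 j]
    refine Finset.sum_eq_zero fun i _ => ?_
    by_cases hi : i ∈ Z
    · simp [hi, hZ i hi j hj]
    · simp [hi]
  have hw2 : ∀ j, w j = ∑ i, w i * K i j := fun j => by
    rw [hw1 j]
    refine Finset.sum_congr rfl fun i _ => ?_
    by_cases hi : i ∈ Z <;> simp [hi, hwZ]
  have habs : ∀ j, |w j| ≤ ∑ i, |w i| * K i j := fun j => by
    conv_lhs => rw [hw2 j]
    refine (Finset.abs_sum_le_sum_abs _ _).trans_eq ?_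
    exact Finset.sum_congr rfl fun i _ => by rw [abs_mul, abs_of_nonneg (hK.1 i j)]
  have hsum : ∑ j, |w j| = ∑ j, ∑ i, |w i| * K i j := by
    rw [Finset.sum_comm]
    simp [← Finset.mul_sum, hK.2]
  have heq := (Finset.sum_eq_sum_iff_of_le fun j _ => habs j).1 hsum
  have hpos : 0 < ∑ j, |w j| := by
    obtain ⟨i, hi⟩ := Function.ne_iff.1 hw0
    exact Finset.sum_pos' (fun _ _ => abs_nonneg _) ⟨i, Finset.mem_univ _, abs_pos.2 hi⟩
  refine ⟨fun i => |w i| / ∑ j, |w j|, ⟨⟨fun i => by positivity, ?_⟩, ?_⟩, fun i hi => ?_⟩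
  · rw [← Finset.sum_div, div_self hpos.ne']
  · ext j
    simp only [Matrix.vecMul, dotProduct]
    rw [heq j (Finset.mem_univ _), Finset.sum_div]
    exact Finset.sum_congr rfl fun i _ => by ring
  · simp [hwZ i hi]

/-- Doeblin minorization for the chain observed right after failures: the column of some state
`j₀` (the vector `g`) is bounded below. -/
lemma exists_doeblin (hK : IsStochastic K) (hμ : HasUniqueStationaryDist K μ)
    (hp : ∀ i, p i ∈ Set.Ioo (0 : ℝ) 1) :
    ∃ (j₀ : Fin N) (g : Fin N → ℝ) (ε : ℝ), 0 < ε ∧ ε ≤ 1 / 2 ∧ (∀ i, ε ≤ g i) ∧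
      ∀ i, g i - p i * (K *ᵥ g) i = (1 - p i) * K i j₀ := by
  obtain ⟨j₀, hj₀⟩ : ∃ j, μ j ≠ 0 := by
    by_contra! h
    have := hμ.1.1.2
    simp [h] at this
  obtain ⟨g, hg⟩ := hK.exists_resolvent hp fun i => (1 - p i) * K i j₀
  have hg0 : ∀ i, 0 ≤ g i := hK.nonneg_of_le hp fun i => by
    have := mul_nonneg (sub_nonneg.2 (hp i).2.le) (hK.1 i j₀)
    linarith [hg i]
  have hKg : ∀ i, 0 ≤ (K *ᵥ g) i := hK.le_mulVec hg0
  have hpos : ∀ i, 0 < g i := by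
    by_contra! h
    obtain ⟨i₀, hi₀⟩ := h
    have hz : ∀ i, g i = 0 → (K *ᵥ g) i = 0 ∧ K i j₀ = 0 := fun i hi => by
      have h1 := hg i
      have h2 := mul_nonneg (hp i).1.le (hKg i)
      have h3 := mul_nonneg (sub_nonneg.2 (hp i).2.le) (hK.1 i j₀)
      have h4 : p i * (K *ᵥ g) i = 0 := by linarith
      have h5 : (1 - p i) * K i j₀ = 0 := by linarith
      exact ⟨(mul_eq_zero.1 h4).resolve_left (hp i).1.ne',
        (mul_eq_zero.1 h5).resolve_left (sub_pos.2 (hp i).2).ne'⟩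
    obtain ⟨w, hw, hwZ⟩ := hK.exists_stationary_of_closed (Z := {i | g i = 0})
      ⟨i₀, le_antisymm hi₀ (hg0 i₀)⟩ fun i hi j hj => by
        have hi' := (hz i hi).1
        simp only [Matrix.mulVec, dotProduct] at hi'
        have := (Finset.sum_eq_zero_iff_of_nonneg
          fun j _ => mul_nonneg (hK.1 i j) (hg0 j)).1 hi' j (Finset.mem_univ _)
        exact (mul_eq_zero.1 this).resolve_right hj
    obtain rfl := hμ.2 w hw
    refine hj₀ ?_
    rw [← congrFun hw.2 j₀]
    simp only [Matrix.vecMul, dotProduct]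
    refine Finset.sum_eq_zero fun i _ => ?_
    by_cases hi : g i = 0
    · rw [(hz i hi).2, mul_zero]
    · rw [hwZ i hi, zero_mul]
  have : Nonempty (Fin N) := ⟨j₀⟩
  obtain ⟨k, hk⟩ := Finite.exists_min g
  exact ⟨j₀, g, min (g k) (1 / 2), lt_min (hpos k) (by norm_num), min_le_right _ _,
    fun i => (min_le_left _ _).trans (hk i), hg⟩

/-- One step of the failure-time chain shrinks the range of a function by the factor `1 - ε`. -/
lemma IsStochastic.range_contraction (hK : IsStochastic K) (hp : ∀ i, p i ∈ Set.Ioo (0 : ℝ) 1)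
    {j₀ : Fin N} {g : Fin N → ℝ} {ε : ℝ} (hε : ∀ i, ε ≤ g i)
    (hg : ∀ i, g i - p i * (K *ᵥ g) i = (1 - p i) * K i j₀) {x y : Fin N → ℝ}
    (hxy : ∀ i, x i - p i * (K *ᵥ x) i = (1 - p i) * (K *ᵥ y) i) {a : ℝ} (ha : ∀ i, a ≤ y i)
    (i : Fin N) : a + ε * (y j₀ - a) ≤ x i := by
  have hcol : ∀ i, (K *ᵥ Pi.single j₀ (y j₀ - a)) i = K i j₀ * (y j₀ - a) := fun i => by
    simp [Matrix.mulVec, dotProduct, Pi.single_apply]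
  have key := hK.nonneg_of_le hp (v := x - (fun _ => a) - (y j₀ - a) • g) (fun i => by
    have h1 : (0 : ℝ) ≤ (K *ᵥ (y - (fun _ => a) - Pi.single j₀ (y j₀ - a))) i := by
      refine hK.le_mulVec (fun k => ?_) i
      by_cases hk : k = j₀
      · subst hk; simp
      · simpa [hk] using ha k
    simp only [Matrix.mulVec_sub, Matrix.mulVec_smul, Pi.sub_apply, Pi.smul_apply, smul_eq_mul,
      hK.mulVec_const, hcol] at h1 ⊢
    have h2 := mul_nonneg (sub_nonneg.2 (hp i).2.le) h1
    linear_combination h2 + (y j₀ - a) * hg i - hxy i) i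
  simp only [Pi.sub_apply, Pi.smul_apply, smul_eq_mul] at key
  nlinarith [mul_le_mul_of_nonneg_right (hε i) (sub_nonneg.2 (ha j₀))]


lemma exists_uniform_bound (hp : ∀ i, p i ∈ Set.Ioo (0 : ℝ) 1) :
    ∃ q : ℝ, 0 < q ∧ q < 1 ∧ ∀ i, p i ≤ q := by
  rcases isEmpty_or_nonempty (Fin N) with h | h
  · exact ⟨1 / 2, by norm_num, by norm_num, fun i => h.elim i⟩
  · obtain ⟨k, hk⟩ := Finite.exists_max p
    exact ⟨p k, (hp k).1, (hp k).2, hk⟩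

/-- `μ D_{1-p} K v`, a multiple of the stationary mean of `v` along the failure-time chain. -/
def failMean (K : Matrix (Fin N) (Fin N) ℝ) (μ p v : Fin N → ℝ) : ℝ :=
  ∑ i, μ i * ((1 - p i) * (K *ᵥ v) i)

lemma IsStationaryDist.sum_mulVec (hμ : IsStationaryDist K μ) (v : Fin N → ℝ) :
    ∑ i, μ i * (K *ᵥ v) i = ∑ i, μ i * v i := by
  change μ ⬝ᵥ (K *ᵥ v) = μ ⬝ᵥ v
  rw [Matrix.dotProduct_mulVec, hμ.2]

lemma IsStationaryDist.sum_one_sub (hμ : IsStationaryDist K μ) (p : Fin N → ℝ) :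
    ∑ i, μ i * (1 - p i) = 1 - ∑ i, μ i * p i := by
  simp [mul_sub, Finset.sum_sub_distrib, hμ.1.2]

lemma IsStationaryDist.one_sub_mean_pos (hμ : IsStationaryDist K μ) (hp : ∀ i, p i ∈ Set.Ioo (0 : ℝ) 1) :
    0 < 1 - ∑ i, μ i * p i := by
  rw [← hμ.sum_one_sub]
  obtain ⟨j, hj⟩ : ∃ j, μ j ≠ 0 := by
    by_contra! h
    have := hμ.1.2
    simp [h] at this
  exact Finset.sum_pos' (fun i _ => mul_nonneg (hμ.1.1 i) (sub_nonneg.2 (hp i).2.le))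
    ⟨j, Finset.mem_univ _, mul_pos ((hμ.1.1 j).lt_of_ne' hj) (sub_pos.2 (hp j).2)⟩

lemma IsStationaryDist.failMean_const (hK : IsStochastic K) (hμ : IsStationaryDist K μ) (c : ℝ) :
    failMean K μ p (fun _ => c) = c * (1 - ∑ i, μ i * p i) := by
  simp only [failMean, hK.mulVec_const]
  rw [← hμ.sum_one_sub, Finset.mul_sum]
  exact Finset.sum_congr rfl fun i _ => by ring

/-- The failure-time chain converges geometrically to equilibrium. -/
lemma exists_geometric_decay (hK : IsStochastic K) (hμ : HasUniqueStationaryDist K μ)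
    (hp : ∀ i, p i ∈ Set.Ioo (0 : ℝ) 1) {e : ℕ → Fin N → ℝ}
    (he : ∀ n i, e (n + 1) i - p i * (K *ᵥ e (n + 1)) i = (1 - p i) * (K *ᵥ e n) i)
    (he0 : failMean K μ p (e 0) = 0) :
    ∃ C ρ : ℝ, 0 ≤ C ∧ 0 < ρ ∧ ρ < 1 ∧ ∀ n i, |e n i| ≤ C * ρ ^ n := by
  obtain ⟨j₀, g, ε, hε0, hε1, hεg, hg⟩ := exists_doeblin hK hμ hp
  have : Nonempty (Fin N) := ⟨j₀⟩
  have hmean : ∀ n, failMean K μ p (e n) = 0 := by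
    intro n
    induction n with
    | zero => exact he0
    | succ n ih =>
      have h1 : failMean K μ p (e (n + 1)) = failMean K μ p (e n) := by
        have h2 := hμ.1.sum_mulVec (e (n + 1))
        have h3 : ∑ i, μ i * (e (n + 1) i - p i * (K *ᵥ e (n + 1)) i) = failMean K μ p (e n) :=
          Finset.sum_congr rfl fun i _ => by rw [he]
        have h4 : failMean K μ p (e (n + 1)) = ∑ i, μ i * (K *ᵥ e (n + 1)) i -
            ∑ i, μ i * (p i * (K *ᵥ e (n + 1)) i) := by
          rw [failMean, ← Finset.sum_sub_distrib]
          exact Finset.sum_congr rfl fun i _ => by ring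
        rw [h4, h2, ← h3, ← Finset.sum_sub_distrib]
        exact Finset.sum_congr rfl fun i _ => by ring
      rw [h1, ih]
  have hlow : ∀ (v : Fin N → ℝ) (a : ℝ), failMean K μ p v = 0 → (∀ i, a ≤ v i) → a ≤ 0 := by
    intro v a hv ha
    have h1 := hμ.1.failMean_const (p := p) hK a
    have h2 : failMean K μ p (fun _ => a) ≤ failMean K μ p v :=
      Finset.sum_le_sum fun i _ => mul_le_mul_of_nonneg_left (mul_le_mul_of_nonneg_left
        (hK.mulVec_mono ha i) (sub_nonneg.2 (hp i).2.le)) (hμ.1.1.1 i)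
    nlinarith [hμ.1.one_sub_mean_pos hp]
  have hneg : ∀ v, failMean K μ p (-v) = - failMean K μ p v := fun v => by
    simp [failMean, Matrix.mulVec_neg]
  obtain ⟨k, hk⟩ := Finite.exists_min (e 0)
  obtain ⟨l, hl⟩ := Finite.exists_max (e 0)
  have hrange : ∀ n, ∃ a b, b - a = (1 - ε) ^ n * (e 0 l - e 0 k) ∧
      ∀ i, a ≤ e n i ∧ e n i ≤ b := by
    intro n
    induction n with
    | zero => exact ⟨e 0 k, e 0 l, by simp, fun i => ⟨hk i, hl i⟩⟩
    | succ n ih =>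
      obtain ⟨a, b, hab, h⟩ := ih
      refine ⟨a + ε * (e n j₀ - a), b - ε * (b - e n j₀), ?_, fun i => ⟨?_, ?_⟩⟩
      · rw [pow_succ]
        linear_combination (1 - ε) * hab
      · exact hK.range_contraction hp hεg hg (he n) (fun i => (h i).1) i
      · have := hK.range_contraction hp hεg hg (x := -e (n + 1)) (y := -e n)
          (fun i => by
            simp only [Matrix.mulVec_neg, Pi.neg_apply]
            linear_combination -(he n i)) (a := -b) (fun i => neg_le_neg (h i).2) i
        simp only [Pi.neg_apply] at this
        linarith
  refine ⟨e 0 l - e 0 k, 1 - ε, sub_nonneg.2 (hk l), by linarith, by linarith, fun n i => ?_⟩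
  obtain ⟨a, b, hab, h⟩ := hrange n
  have ha := hlow _ a (hmean n) fun i => (h i).1
  have hb := hlow (-e n) (-b) (by rw [hneg, hmean, neg_zero]) fun i => neg_le_neg (h i).2
  rw [abs_le]
  constructor <;> linarith [h i]

/-- Geometrically small forcing keeps solutions of the failure-time recursion bounded. -/
lemma exists_bound_of_forcing (hK : IsStochastic K) (hp : ∀ i, p i ∈ Set.Ioo (0 : ℝ) 1)
    {f : ℕ → Fin N → ℝ} {C ρ : ℝ} (hC : 0 ≤ C) (hρ0 : 0 < ρ) (hρ1 : ρ < 1)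
    (hf : ∀ n i, |f (n + 1) i - p i * (K *ᵥ f (n + 1)) i - (1 - p i) * (K *ᵥ f n) i|
      ≤ C * ρ ^ n) : ∃ D, 0 ≤ D ∧ ∀ n i, |f n i| ≤ D := by
  obtain ⟨q, -, hq1, hq⟩ := exists_uniform_bound hp
  set C' := C / (1 - q) with hC'
  have hC'0 : 0 ≤ C' := div_nonneg hC (by linarith)
  have hCq : C' * (1 - q) = C := div_mul_cancel₀ _ (by linarith)
  set D₀ := ∑ i, |f 0 i|
  have hD₀ : 0 ≤ D₀ := Finset.sum_nonneg fun i _ => abs_nonneg _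
  have hρ : 0 < 1 - ρ := by linarith
  have one_side : ∀ (g : ℕ → Fin N → ℝ), (∀ i, g 0 i ≤ D₀) →
      (∀ n i, g (n + 1) i - p i * (K *ᵥ g (n + 1)) i - (1 - p i) * (K *ᵥ g n) i ≤ C * ρ ^ n) →
      ∀ n i, g n i ≤ D₀ + C' * ((1 - ρ ^ n) / (1 - ρ)) := by
    intro g hg0 hg n
    induction n with
    | zero => simpa using hg0
    | succ n ih =>
      intro i
      have key := hK.nonneg_of_le hp
        (v := (fun _ => D₀ + C' * ((1 - ρ ^ (n + 1)) / (1 - ρ))) - g (n + 1)) (fun i => by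
          simp only [Matrix.mulVec_sub, Pi.sub_apply, hK.mulVec_const]
          have h1 := mul_le_mul_of_nonneg_left (hK.mulVec_le ih i) (sub_nonneg.2 (hp i).2.le)
          have h2 := hg n i
          have h3 : C * ρ ^ n ≤ C' * (1 - p i) * ρ ^ n := by
            rw [← hCq]
            gcongr
            exact hq i
          have h4 : (1 - ρ ^ (n + 1)) / (1 - ρ) = (1 - ρ ^ n) / (1 - ρ) + ρ ^ n := by
            field_simp
            ring
          rw [h4]
          linarith) i
      simp only [Pi.sub_apply] at key
      linarith
  have hbound : ∀ n : ℕ, D₀ + C' * ((1 - ρ ^ n) / (1 - ρ)) ≤ D₀ + C' * (1 / (1 - ρ)) := fun n => by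
    gcongr
    linarith [pow_pos hρ0 n]
  have h0 : ∀ i, |f 0 i| ≤ D₀ := fun i =>
    Finset.single_le_sum (f := fun i => |f 0 i|) (fun i _ => abs_nonneg _) (Finset.mem_univ i)
  refine ⟨D₀ + C' * (1 / (1 - ρ)), by positivity, fun n i => abs_le'.2 ⟨?_, ?_⟩⟩
  · exact (one_side f (fun i => (le_abs_self _).trans (h0 i))
      (fun n i => (le_abs_self _).trans (hf n i)) n i).trans (hbound n)
  · exact (one_side (fun n => -f n) (fun i => (neg_le_abs _).trans (h0 i))
      (fun n i => by
        refine le_trans (le_of_eq ?_) ((neg_le_abs _).trans (hf n i))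
        simp only [Matrix.mulVec_neg, Pi.neg_apply]
        ring) n i).trans (hbound n)

/-- The matrix `I - K + (𝟏 - 𝐩) μ D_{1-p} K / (1 - p̄)`. -/
def poissonMatrix (K : Matrix (Fin N) (Fin N) ℝ) (μ p : Fin N → ℝ) : Matrix (Fin N) (Fin N) ℝ :=
  1 - K + (1 / (1 - ∑ i, μ i * p i)) •
    Matrix.vecMulVec (fun i => 1 - p i)
      (Matrix.vecMul μ (Matrix.diagonal (fun i => 1 - p i) * K))

lemma sum_vecMul_diagonal_mul (d v : Fin N → ℝ) :
    ∑ i, Matrix.vecMul μ (Matrix.diagonal d * K) i * v i = ∑ i, μ i * (d i * (K *ᵥ v) i) := by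
  change Matrix.vecMul μ (Matrix.diagonal d * K) ⬝ᵥ v = _
  rw [← Matrix.dotProduct_mulVec, ← Matrix.mulVec_mulVec]
  simp [dotProduct, Matrix.mulVec_diagonal]

lemma poissonMatrix_mulVec (v : Fin N → ℝ) (i : Fin N) :
    (poissonMatrix K μ p *ᵥ v) i =
      v i - (K *ᵥ v) i + (1 - p i) * failMean K μ p v / (1 - ∑ i, μ i * p i) := by
  rw [failMean, ← sum_vecMul_diagonal_mul]
  simp only [poissonMatrix, Matrix.add_mulVec, Matrix.sub_mulVec, Matrix.smul_mulVec,
    Matrix.one_mulVec, Matrix.vecMulVec_mulVec, Pi.add_apply, Pi.sub_apply, Pi.smul_apply,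
    smul_eq_mul, dotProduct, MulOpposite.smul_eq_mul_unop, MulOpposite.unop_op]
  ring

lemma failMean_eq_of_poissonMatrix_mulVec (hμ : IsStationaryDist K μ)
    (hp : ∀ i, p i ∈ Set.Ioo (0 : ℝ) 1) {v u : Fin N → ℝ} (h : poissonMatrix K μ p *ᵥ v = u) :
    failMean K μ p v = ∑ i, μ i * u i := by
  have hpos := hμ.one_sub_mean_pos hp
  have h2 : ∑ i, μ i * u i = ∑ i, μ i * v i - ∑ i, μ i * (K *ᵥ v) i +
      (∑ i, μ i * (1 - p i)) * (failMean K μ p v / (1 - ∑ i, μ i * p i)) := by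
    rw [Finset.sum_mul, ← Finset.sum_sub_distrib, ← Finset.sum_add_distrib]
    refine Finset.sum_congr rfl fun i _ => ?_
    rw [← h, poissonMatrix_mulVec]
    ring
  rw [h2, hμ.sum_one_sub, hμ.sum_mulVec, mul_div_cancel₀ _ hpos.ne']
  ring

lemma isUnit_poissonMatrix (hK : IsStochastic K) (hμ : HasUniqueStationaryDist K μ)
    (hp : ∀ i, p i ∈ Set.Ioo (0 : ℝ) 1) : IsUnit (poissonMatrix K μ p).det := by
  rw [← Matrix.isUnit_iff_isUnit_det, ← Matrix.mulVec_injective_iff_isUnit]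
  have hinj : Function.Injective (poissonMatrix K μ p).mulVecLin := by
    rw [injective_iff_map_eq_zero]
    intro v hv
    rw [Matrix.mulVecLin_apply] at hv
    have hmean : failMean K μ p v = 0 := by
      simpa using failMean_eq_of_poissonMatrix_mulVec hμ.1 hp hv
    have hfix : ∀ i, v i = (K *ᵥ v) i := fun i => by
      have := congrFun hv i
      rw [poissonMatrix_mulVec, hmean] at this
      simp at this
      linarith
    have hgeom := exists_geometric_decay hK hμ hp (e := fun _ => v)
      (fun _ i => by rw [← hfix i]; ring) hmean
    obtain ⟨C, ρ, -, hρ0, hρ1, hbound⟩ := hgeom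
    ext i
    have hlim : Tendsto (fun n : ℕ => C * ρ ^ n) atTop (nhds 0) := by
      simpa using (tendsto_pow_atTop_nhds_zero_of_lt_one hρ0.le hρ1).const_mul C
    exact abs_nonpos_iff.1 (ge_of_tendsto' hlim fun n => hbound n i)
  exact hinj

lemma poissonMatrix_inv_spec (hK : IsStochastic K) (hμ : HasUniqueStationaryDist K μ)
    (hp : ∀ i, p i ∈ Set.Ioo (0 : ℝ) 1) (u : Fin N → ℝ) :
    failMean K μ p ((poissonMatrix K μ p)⁻¹ *ᵥ u) = ∑ i, μ i * u i ∧
    ∀ i, ((poissonMatrix K μ p)⁻¹ *ᵥ u) i - (K *ᵥ ((poissonMatrix K μ p)⁻¹ *ᵥ u)) i =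
      u i - (1 - p i) * (∑ i, μ i * u i) / (1 - ∑ i, μ i * p i) := by
  have h : poissonMatrix K μ p *ᵥ ((poissonMatrix K μ p)⁻¹ *ᵥ u) = u := by
    rw [Matrix.mulVec_mulVec, Matrix.mul_nonsing_inv _ (isUnit_poissonMatrix hK hμ hp),
      Matrix.one_mulVec]
  have hmean := failMean_eq_of_poissonMatrix_mulVec hμ.1 hp h
  refine ⟨hmean, fun i => ?_⟩
  have := congrFun h i
  rw [poissonMatrix_mulVec, hmean] at this
  linarith

lemma abs_sum_mul_le {η v : Fin N → ℝ} (hη : IsProbVec η) {D : ℝ} (h : ∀ i, |v i| ≤ D) :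
    |∑ i, η i * v i| ≤ D := by
  refine (Finset.abs_sum_le_sum_abs _ _).trans ?_
  calc ∑ i, |η i * v i| ≤ ∑ i, η i * D := Finset.sum_le_sum fun i _ => by
        rw [abs_mul, abs_of_nonneg (hη.1 i)]
        exact mul_le_mul_of_nonneg_left (h i) (hη.1 i)
    _ = D := by rw [← Finset.sum_mul, hη.2, one_mul]

lemma exists_forall_abs_le (v : Fin N → ℝ) : ∃ D, 0 ≤ D ∧ ∀ i, |v i| ≤ D :=
  ⟨∑ i, |v i|, Finset.sum_nonneg fun _ _ => abs_nonneg _, fun i =>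
    Finset.single_le_sum (f := fun i => |v i|) (fun _ _ => abs_nonneg _) (Finset.mem_univ i)⟩

lemma exists_nat_mul_pow_le {ρ : ℝ} (hρ0 : 0 < ρ) (hρ1 : ρ < 1) :
    ∃ B : ℝ, 0 ≤ B ∧ ∀ n : ℕ, n * ρ ^ n ≤ B := by
  obtain ⟨B, hB⟩ := (tendsto_self_mul_const_pow_of_lt_one hρ0.le hρ1).bddAbove_range
  have hB' : ∀ n : ℕ, n * ρ ^ n ≤ B := fun n => hB ⟨n, rfl⟩
  exact ⟨B, by simpa using hB' 0, hB'⟩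

lemma rvecGen_spec (hK : IsStochastic K) (hμ : HasUniqueStationaryDist K μ)
    (hp : ∀ i, p i ∈ Set.Ioo (0 : ℝ) 1) {lam : ℝ}
    (hlam : lam = (∑ i, μ i * p i) / (1 - ∑ i, μ i * p i)) :
    failMean K μ p (rvecGen K μ p) = 0 ∧
    ∀ i, rvecGen K μ p i - (K *ᵥ rvecGen K μ p) i = p i - lam * (1 - p i) := by
  obtain ⟨h1, h2⟩ := poissonMatrix_inv_spec hK hμ hp p
  have hpos := hμ.1.one_sub_mean_pos hp
  have hr : rvecGen K μ p = (poissonMatrix K μ p)⁻¹ *ᵥ p - fun _ => lam := by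
    ext i
    simp [rvecGen, poissonMatrix, hlam]
  have hconst := hμ.1.failMean_const (p := p) hK lam
  constructor
  · have hsub : failMean K μ p (rvecGen K μ p) =
        failMean K μ p ((poissonMatrix K μ p)⁻¹ *ᵥ p) - failMean K μ p (fun _ => lam) := by
      rw [hr]
      simp only [failMean, Matrix.mulVec_sub, Pi.sub_apply, mul_sub, Finset.sum_sub_distrib]
    rw [hsub, h1, hconst, hlam, div_mul_cancel₀ _ hpos.ne', sub_self]
  · intro i
    rw [hr, Matrix.mulVec_sub]
    simp only [Pi.sub_apply, hK.mulVec_const]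
    rw [hlam]
    linear_combination h2 i

/-- Second-order asymptotics for the moment recursions of the forward branching-like process. -/
lemma exists_variance_bound (hK : IsStochastic K) (hμ : HasUniqueStationaryDist K μ)
    (hp : ∀ i, p i ∈ Set.Ioo (0 : ℝ) 1) {lam ν : ℝ}
    (hlam : lam = (∑ i, μ i * p i) / (1 - ∑ i, μ i * p i))
    (hν : ν = (1 + lam) *
      (lam + 2 * ∑ i, Matrix.vecMul μ (Matrix.diagonal p * K) i * rvecGen K μ p i))
    {M Q : ℕ → Fin N → ℝ} (hM0 : M 0 = 0)
    (hM : ∀ n i, M (n + 1) i - p i * (K *ᵥ M (n + 1)) i = p i + (1 - p i) * (K *ᵥ M n) i)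
    (hQ : ∀ n i, Q (n + 1) i - p i * (K *ᵥ Q (n + 1)) i =
      p i + 2 * (p i * (K *ᵥ M (n + 1)) i) + (1 - p i) * (K *ᵥ Q n) i) :
    ∃ C, 0 < C ∧ ∀ (n : ℕ) (η : Fin N → ℝ), IsProbVec η →
      |∑ i, η i * Q n i - (∑ i, η i * M n i) ^ 2 - n * ν| ≤ C := by
  have hpos := hμ.1.one_sub_mean_pos hp
  obtain ⟨hrmean, hr⟩ := rvecGen_spec hK hμ hp hlam
  set r := rvecGen K μ p
  set pbar := ∑ i, μ i * p i with hpbar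
  have hlam' : lam * (1 - pbar) = pbar := by rw [hlam, div_mul_cancel₀ _ hpos.ne']
  let c : Fin N → ℝ := fun i => p i + 2 * lam * p i + 2 * (p i * (K *ᵥ r) i)
    - (lam ^ 2 + ν) * (1 - p i) - 2 * lam * (r i - p i * (K *ᵥ r) i)
  have hc : ∑ i, μ i * c i = 0 := by
    have h1 : ∑ i, μ i * (r i - p i * (K *ᵥ r) i) = 0 := by
      rw [← hrmean, failMean]
      have := hμ.1.sum_mulVec r
      simp only [mul_sub, sub_mul, Finset.sum_sub_distrib, one_mul] at this ⊢
      linarith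
    have h2 : ∑ i, μ i * c i = (1 + 2 * lam) * pbar + 2 * ∑ i, μ i * (p i * (K *ᵥ r) i)
        - (lam ^ 2 + ν) * ∑ i, μ i * (1 - p i)
        - 2 * lam * ∑ i, μ i * (r i - p i * (K *ᵥ r) i) := by
      rw [hpbar]
      simp only [Finset.mul_sum, ← Finset.sum_add_distrib, ← Finset.sum_sub_distrib, c]
      exact Finset.sum_congr rfl fun i _ => by ring
    rw [h2, h1, hμ.1.sum_one_sub, hν, sum_vecMul_diagonal_mul]
    set S := ∑ i, μ i * (p i * (K *ᵥ r) i)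
    linear_combination (-(2 * lam) - 1 - 2 * S) * hlam'
  obtain ⟨-, hs⟩ := poissonMatrix_inv_spec hK hμ hp c
  set s := (poissonMatrix K μ p)⁻¹ *ᵥ c
  simp only [hc, mul_zero, zero_div, sub_zero] at hs
  let e : ℕ → Fin N → ℝ := fun n => (fun _ => n * lam) + r - M n
  have he : ∀ n i, e (n + 1) i - p i * (K *ᵥ e (n + 1)) i = (1 - p i) * (K *ᵥ e n) i :=
    fun n i => by
      simp only [e, Matrix.mulVec_add, Matrix.mulVec_sub, Pi.add_apply, Pi.sub_apply,
        hK.mulVec_const]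
      push_cast
      linear_combination hr i - hM n i
  have he0 : failMean K μ p (e 0) = 0 := by
    have : e 0 = r := by ext i; simp [e, hM0]
    rw [this, hrmean]
  obtain ⟨C₁, ρ, hC₁, hρ0, hρ1, hdecay⟩ := exists_geometric_decay hK hμ hp he he0
  let d : ℕ → Fin N → ℝ := fun n =>
    Q n - (fun _ => lam ^ 2 * n ^ 2 + n * ν) - (2 * lam * n) • r - s
  have hd : ∀ n i, d (n + 1) i - p i * (K *ᵥ d (n + 1)) i - (1 - p i) * (K *ᵥ d n) i =
      -(2 * (p i * (K *ᵥ e (n + 1)) i)) := fun n i => by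
    have hsi := hs i
    simp only [d, e, c, Matrix.mulVec_add, Matrix.mulVec_sub, Matrix.mulVec_smul, Pi.add_apply,
      Pi.sub_apply, Pi.smul_apply, smul_eq_mul, hK.mulVec_const] at hsi ⊢
    push_cast
    linear_combination hQ n i - hsi - 2 * lam * n * hr i
  obtain ⟨D, hD0, hD⟩ := exists_bound_of_forcing hK hp (f := d) (C := 2 * C₁) (by positivity)
    hρ0 hρ1 (fun n i => by
      rw [hd, abs_neg, abs_mul, abs_mul, abs_two, abs_of_pos (hp i).1, mul_assoc]
      have h1 : |(K *ᵥ e (n + 1)) i| ≤ C₁ * ρ ^ (n + 1) := abs_le.2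
        ⟨hK.le_mulVec (fun j => (abs_le.1 (hdecay (n + 1) j)).1) i,
          hK.mulVec_le (fun j => (abs_le.1 (hdecay (n + 1) j)).2) i⟩
      have h2 : C₁ * ρ ^ (n + 1) ≤ C₁ * ρ ^ n := by
        gcongr C₁ * ?_
        exact pow_le_pow_of_le_one hρ0.le hρ1.le (Nat.le_succ n)
      have h3 : p i * |(K *ᵥ e (n + 1)) i| ≤ 1 * (C₁ * ρ ^ n) := by
        gcongr
        · exact (hp i).2.le
        · exact h1.trans h2
      linarith)
  obtain ⟨R, hR0, hR⟩ := exists_forall_abs_le r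
  obtain ⟨S, hS0, hS⟩ := exists_forall_abs_le s
  obtain ⟨B, hB0, hB⟩ := exists_nat_mul_pow_le hρ0 hρ1
  refine ⟨S + D + 2 * |lam| * (C₁ * B) + (R + C₁) ^ 2 + 1, by positivity, fun n η hη => ?_⟩
  have hηr := abs_sum_mul_le hη hR
  have hηs := abs_sum_mul_le hη hS
  have hηd := abs_sum_mul_le hη (hD n)
  have hηe := abs_sum_mul_le hη (hdecay n)
  have hMe : ∑ i, η i * M n i = n * lam + ∑ i, η i * r i - ∑ i, η i * e n i := by
    have : ∀ i, η i * M n i = η i * (n * lam) + η i * r i - η i * e n i := fun i => by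
      simp only [e, Pi.add_apply, Pi.sub_apply]
      ring
    simp only [this, Finset.sum_add_distrib, Finset.sum_sub_distrib, ← Finset.sum_mul, hη.2,
      one_mul]
  have hQd : ∑ i, η i * Q n i = lam ^ 2 * n ^ 2 + n * ν + 2 * lam * n * ∑ i, η i * r i +
      ∑ i, η i * s i + ∑ i, η i * d n i := by
    have : ∀ i, η i * Q n i = η i * (lam ^ 2 * n ^ 2 + n * ν) + 2 * lam * n * (η i * r i) +
        η i * s i + η i * d n i := fun i => by
      simp only [d, Pi.sub_apply, Pi.smul_apply, smul_eq_mul]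
      ring
    simp only [this, Finset.sum_add_distrib, ← Finset.sum_mul, ← Finset.mul_sum, hη.2, one_mul]
  set ηr := ∑ i, η i * r i
  set ηs := ∑ i, η i * s i
  set ηd := ∑ i, η i * d n i
  set ηe := ∑ i, η i * e n i
  have hsplit : ∑ i, η i * Q n i - (∑ i, η i * M n i) ^ 2 - n * ν =
      ηs + ηd + 2 * lam * (n * ηe) - (ηr - ηe) ^ 2 := by
    rw [hMe, hQd]
    ring
  have h1 : |2 * lam * (n * ηe)| ≤ 2 * |lam| * (C₁ * B) := by
    rw [abs_mul, abs_mul, abs_two, abs_mul, Nat.abs_cast]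
    refine mul_le_mul_of_nonneg_left ?_ (by positivity)
    calc (n : ℝ) * |ηe| ≤ n * (C₁ * ρ ^ n) := by gcongr
      _ = C₁ * (n * ρ ^ n) := by ring
      _ ≤ C₁ * B := by gcongr; exact hB n
  have h2 : |(ηr - ηe) ^ 2| ≤ (R + C₁) ^ 2 := by
    rw [abs_pow]
    gcongr
    refine (abs_sub _ _).trans (add_le_add hηr (hηe.trans ?_))
    exact mul_le_of_le_one_right hC₁ (pow_le_one₀ hρ0.le hρ1.le)
  rw [hsplit]
  rw [abs_le] at *
  constructor <;> linarith

end LinearAlgebra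

section Law

variable {N : ℕ} {K : Matrix (Fin N) (Fin N) ℝ} {p μ : Fin N → ℝ}

/-- Conditioning on the first toss: `v₁` describes what follows a success, `v₀` what follows a
failure. -/
def branchLaw (K : Matrix (Fin N) (Fin N) ℝ) (p v₁ v₀ : Fin N → ℝ) : Fin N → ℝ :=
  fun i => p i * (K *ᵥ v₁) i + (1 - p i) * (K *ᵥ v₀) i

/-- `succLaw K p n k i` is the probability of exactly `k` successes before the `n`-th failure when
the cookie chain starts at `i`. -/
def succLaw (K : Matrix (Fin N) (Fin N) ℝ) (p : Fin N → ℝ) : ℕ → ℕ → Fin N → ℝ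
  | 0, 0 => 1
  | 0, _ + 1 => 0
  | n + 1, 0 => branchLaw K p 0 (succLaw K p n 0)
  | n + 1, k + 1 => branchLaw K p (succLaw K p (n + 1) k) (succLaw K p n (k + 1))

lemma succLaw_nonneg (hK : IsStochastic K) (hp : ∀ i, p i ∈ Set.Ioo (0 : ℝ) 1) (n k : ℕ)
    (i : Fin N) : 0 ≤ succLaw K p n k i := by
  have hbranch : ∀ v₁ v₀ : Fin N → ℝ, (∀ i, 0 ≤ v₁ i) → (∀ i, 0 ≤ v₀ i) →
      ∀ i, 0 ≤ branchLaw K p v₁ v₀ i := fun v₁ v₀ h₁ h₀ i =>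
    add_nonneg (mul_nonneg (hp i).1.le (hK.le_mulVec h₁ i))
      (mul_nonneg (sub_nonneg.2 (hp i).2.le) (hK.le_mulVec h₀ i))
  induction n, k using succLaw.induct generalizing i with
  | case1 => simp [succLaw]
  | case2 => simp [succLaw]
  | case3 n ih =>
    rw [succLaw]
    exact hbranch _ _ (fun _ => le_rfl) ih i
  | case4 n k ih₁ ih₀ =>
    rw [succLaw]
    exact hbranch _ _ ih₁ ih₀ i

lemma exists_succLaw_le (hK : IsStochastic K) (hp : ∀ i, p i ∈ Set.Ioo (0 : ℝ) 1) :
    ∃ B ρ : ℝ, 0 < ρ ∧ ρ < 1 ∧ ∀ n k i, succLaw K p n k i ≤ B ^ n * ρ ^ k := by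
  obtain ⟨q, hq0, hq1, hq⟩ := exists_uniform_bound hp
  set ρ := (1 + q) / 2 with hρ
  have hρ0 : 0 < ρ := by positivity
  have hqρ : 0 < ρ - q := by rw [hρ]; linarith
  set B := ρ / (ρ - q) with hB
  have hB0 : 0 < B := by positivity
  have hBeq : B * (ρ - q) = ρ := div_mul_cancel₀ _ hqρ.ne'
  have hB1 : 1 ≤ B := by
    rw [hB, one_le_div hqρ]
    linarith
  refine ⟨B, ρ, hρ0, by rw [hρ]; linarith, fun n k i => ?_⟩
  induction n, k using succLaw.induct generalizing i with
  | case1 => simp [succLaw]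
  | case2 k => simpa [succLaw] using pow_nonneg hρ0.le (k + 1)
  | case3 n ih =>
    have h1 := hK.mulVec_le ih i
    have h2 := hK.le_mulVec (succLaw_nonneg hK hp n 0) i
    simp only [succLaw, branchLaw, Matrix.mulVec_zero, Pi.zero_apply, mul_zero, zero_add, pow_zero,
      mul_one] at h1 ⊢
    rw [pow_succ]
    have h3 : B ^ n * 1 ≤ B ^ n * B := by gcongr
    nlinarith [(hp i).1]
  | case4 n k ih₁ ih₀ =>
    have h1 := hK.mulVec_le ih₁ i
    have h0 := hK.mulVec_le ih₀ i
    have h0' := hK.le_mulVec (succLaw_nonneg hK hp n (k + 1)) i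
    have h2 : p i * (K *ᵥ succLaw K p (n + 1) k) i ≤ q * (B ^ (n + 1) * ρ ^ k) :=
      mul_le_mul (hq i) h1 (hK.le_mulVec (succLaw_nonneg hK hp (n + 1) k) i) hq0.le
    have h3 : (1 - p i) * (K *ᵥ succLaw K p n (k + 1)) i ≤ B ^ n * ρ ^ (k + 1) := by
      nlinarith [(hp i).1]
    rw [succLaw]
    refine (add_le_add h2 h3).trans_eq ?_
    rw [pow_succ, pow_succ]
    linear_combination -(B ^ n * ρ ^ k) * hBeq

lemma summable_pow_mul_succLaw (hK : IsStochastic K) (hp : ∀ i, p i ∈ Set.Ioo (0 : ℝ) 1)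
    (j n : ℕ) (i : Fin N) : Summable fun k : ℕ => (k : ℝ) ^ j * succLaw K p n k i := by
  obtain ⟨B, ρ, hρ0, hρ1, h⟩ := exists_succLaw_le hK hp
  have hsum : Summable fun k : ℕ => (k : ℝ) ^ j * ρ ^ k :=
    summable_pow_mul_geometric_of_norm_lt_one j (by rwa [Real.norm_of_nonneg hρ0.le])
  refine Summable.of_nonneg_of_le
    (fun k => mul_nonneg (by positivity) (succLaw_nonneg hK hp n k i)) (fun k => ?_)
    (hsum.mul_left (B ^ n))
  calc (k : ℝ) ^ j * succLaw K p n k i ≤ (k : ℝ) ^ j * (B ^ n * ρ ^ k) := by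
        gcongr
        exact h n k i
    _ = B ^ n * ((k : ℝ) ^ j * ρ ^ k) := by ring

/-- Expectation of `φ` under `succLaw`. -/
def succMean (K : Matrix (Fin N) (Fin N) ℝ) (p : Fin N → ℝ) (φ : ℕ → ℝ) (n : ℕ) : Fin N → ℝ :=
  fun i => ∑' k, φ k * succLaw K p n k i

lemma hasSum_mulVec_succLaw {φ : ℕ → ℝ} {n : ℕ}
    (h : ∀ i, Summable fun k => φ k * succLaw K p n k i) (i : Fin N) :
    HasSum (fun k => φ k * (K *ᵥ succLaw K p n k) i) ((K *ᵥ succMean K p φ n) i) := by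
  have := hasSum_sum (s := Finset.univ) fun j (_ : j ∈ Finset.univ) =>
    ((h j).hasSum.mul_left (K i j))
  refine this.congr_fun ?_
  intro k
  simp only [Matrix.mulVec, dotProduct, Finset.mul_sum]
  exact Finset.sum_congr rfl fun j _ => by ring

lemma succMean_zero (φ : ℕ → ℝ) (i : Fin N) : succMean K p φ 0 i = φ 0 := by
  rw [succMean, tsum_eq_single 0]
  · simp [succLaw]
  · intro k hk
    obtain ⟨k, rfl⟩ := Nat.exists_eq_succ_of_ne_zero hk
    simp [succLaw]

lemma succMean_succ {φ : ℕ → ℝ} {n : ℕ}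
    (h : ∀ n i, Summable fun k => φ k * succLaw K p n k i)
    (h' : ∀ n i, Summable fun k => φ (k + 1) * succLaw K p n k i) (i : Fin N) :
    succMean K p φ (n + 1) i =
      p i * (K *ᵥ succMean K p (fun k => φ (k + 1)) (n + 1)) i +
        (1 - p i) * (K *ᵥ succMean K p φ n) i := by
  have h1 := (hasSum_mulVec_succLaw (h' (n + 1)) i).mul_left (p i)
  have h0 := (hasSum_mulVec_succLaw (h n) i).mul_left (1 - p i)
  rw [← hasSum_nat_add_iff' 1] at h0
  have hsum := h1.add h0
  have key : HasSum (fun k => φ (k + 1) * succLaw K p (n + 1) (k + 1) i)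
      (p i * (K *ᵥ succMean K p (fun k => φ (k + 1)) (n + 1)) i +
        (1 - p i) * (K *ᵥ succMean K p φ n) i - φ 0 * succLaw K p (n + 1) 0 i) := by
    have hval : p i * (K *ᵥ succMean K p (fun k => φ (k + 1)) (n + 1)) i +
        (1 - p i) * (K *ᵥ succMean K p φ n) i - φ 0 * succLaw K p (n + 1) 0 i =
        p i * (K *ᵥ succMean K p (fun k => φ (k + 1)) (n + 1)) i +
          ((1 - p i) * (K *ᵥ succMean K p φ n) i -
            ∑ k ∈ Finset.range 1, (1 - p i) * (φ k * (K *ᵥ succLaw K p n k) i)) := by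
      rw [succLaw, branchLaw, Finset.sum_range_one, Matrix.mulVec_zero, Pi.zero_apply]
      ring
    rw [hval]
    refine hsum.congr_fun fun k => ?_
    rw [succLaw, branchLaw]
    ring
  have := (hasSum_nat_add_iff' (f := fun k => φ k * succLaw K p (n + 1) k i) 1).1
    (by simpa using key)
  exact this.tsum_eq

lemma succMean_one (hK : IsStochastic K) (hp : ∀ i, p i ∈ Set.Ioo (0 : ℝ) 1) (n : ℕ) :
    succMean K p (fun _ => 1) n = 1 := by
  have hs : ∀ n i, Summable fun k => (1 : ℝ) * succLaw K p n k i := fun n i => by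
    simpa using summable_pow_mul_succLaw hK hp 0 n i
  induction n with
  | zero => ext i; exact succMean_zero _ i
  | succ n ih =>
    have h := fun i => succMean_succ (φ := fun _ => 1) (n := n) hs hs i
    simp only [ih, hK.mulVec_one_s11] at h
    set z := succMean K p (fun _ => 1) (n + 1)
    ext i
    have h1 := hK.nonneg_of_le hp (v := z - 1) (fun i => by
      simp only [Matrix.mulVec_sub, Pi.sub_apply, hK.mulVec_one_s11, Pi.one_apply]
      linarith [h i]) i
    have h2 := hK.nonneg_of_le hp (v := 1 - z) (fun i => by
      simp only [Matrix.mulVec_sub, Pi.sub_apply, hK.mulVec_one_s11, Pi.one_apply]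
      linarith [h i]) i
    simp only [Pi.sub_apply, Pi.one_apply] at h1 h2 ⊢
    linarith

lemma succMean_id_succ (hK : IsStochastic K) (hp : ∀ i, p i ∈ Set.Ioo (0 : ℝ) 1) (n : ℕ)
    (i : Fin N) :
    succMean K p (fun k => (k : ℝ)) (n + 1) i -
        p i * (K *ᵥ succMean K p (fun k => (k : ℝ)) (n + 1)) i =
      p i + (1 - p i) * (K *ᵥ succMean K p (fun k => (k : ℝ)) n) i := by
  have hs0 : ∀ n i, Summable fun k => (1 : ℝ) * succLaw K p n k i := fun n i => by
    simpa using summable_pow_mul_succLaw hK hp 0 n i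
  have hs1 : ∀ n i, Summable fun k : ℕ => (k : ℝ) * succLaw K p n k i := fun n i => by
    simpa using summable_pow_mul_succLaw hK hp 1 n i
  have hshift : succMean K p (fun k => ((k + 1 : ℕ) : ℝ)) (n + 1) =
      succMean K p (fun k => (k : ℝ)) (n + 1) + 1 := by
    rw [← succMean_one hK hp (n + 1)]
    ext i
    simp only [succMean, Pi.add_apply]
    rw [← (hs1 _ i).tsum_add (hs0 _ i)]
    exact tsum_congr fun k => by push_cast; ring
  have h := succMean_succ (n := n) hs1 (fun n i =>
    ((hs1 n i).add (hs0 n i)).congr fun k => by push_cast; ring) i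
  rw [hshift, Matrix.mulVec_add, Pi.add_apply, hK.mulVec_one_s11] at h
  linarith

lemma succMean_sq_succ (hK : IsStochastic K) (hp : ∀ i, p i ∈ Set.Ioo (0 : ℝ) 1) (n : ℕ)
    (i : Fin N) :
    succMean K p (fun k => (k : ℝ) ^ 2) (n + 1) i -
        p i * (K *ᵥ succMean K p (fun k => (k : ℝ) ^ 2) (n + 1)) i =
      p i + 2 * (p i * (K *ᵥ succMean K p (fun k => (k : ℝ)) (n + 1)) i) +
        (1 - p i) * (K *ᵥ succMean K p (fun k => (k : ℝ) ^ 2) n) i := by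
  have hs0 : ∀ n i, Summable fun k => (1 : ℝ) * succLaw K p n k i := fun n i => by
    simpa using summable_pow_mul_succLaw hK hp 0 n i
  have hs1 : ∀ n i, Summable fun k : ℕ => (k : ℝ) * succLaw K p n k i := fun n i => by
    simpa using summable_pow_mul_succLaw hK hp 1 n i
  have hs2 := summable_pow_mul_succLaw hK hp 2
  have hshift : succMean K p (fun k => ((k + 1 : ℕ) : ℝ) ^ 2) (n + 1) =
      succMean K p (fun k => (k : ℝ) ^ 2) (n + 1) +
        (2 : ℝ) • succMean K p (fun k => (k : ℝ)) (n + 1) + 1 := by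
    rw [← succMean_one hK hp (n + 1)]
    ext i
    simp only [succMean, Pi.add_apply, Pi.smul_apply, smul_eq_mul]
    rw [← tsum_mul_left, ← (hs2 _ i).tsum_add ((hs1 _ i).mul_left 2),
      ← ((hs2 _ i).add ((hs1 _ i).mul_left 2)).tsum_add (hs0 _ i)]
    exact tsum_congr fun k => by push_cast; ring
  have h := succMean_succ (n := n) hs2 (fun n i =>
    (((hs2 n i).add ((hs1 n i).mul_left 2)).add (hs0 n i)).congr fun k => by push_cast; ring) i
  rw [hshift, Matrix.mulVec_add, Matrix.mulVec_add, Matrix.mulVec_smul, Pi.add_apply,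
    Pi.add_apply, hK.mulVec_one_s11, Pi.smul_apply, smul_eq_mul] at h
  linarith

end Law

section Sequences

/-- Sequences whose tail lies in `S₁` after an initial success and in `S₀` after an initial
failure. -/
def branchSet (S₁ S₀ : Set (ℕ → Bool)) : Set (ℕ → Bool) :=
  {b | (b 0 = true ∧ (fun j => b (j + 1)) ∈ S₁) ∨ (b 0 = false ∧ (fun j => b (j + 1)) ∈ S₀)}

/-- Sequences with exactly `k` successes before the `n`-th failure. -/
def succSet : ℕ → ℕ → Set (ℕ → Bool)
  | 0, 0 => Set.univ
  | 0, _ + 1 => ∅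
  | n + 1, 0 => branchSet ∅ (succSet n 0)
  | n + 1, k + 1 => branchSet (succSet (n + 1) k) (succSet n (k + 1))

lemma card_filter_range_succ (b : ℕ → Bool) (L : ℕ) :
    ((Finset.range (L + 1)).filter fun j => b j = false).card =
      ((Finset.range L).filter fun j => b (j + 1) = false).card + if b 0 = false then 1 else 0 := by
  simp only [Finset.card_filter]
  rw [Finset.sum_range_succ']

/-- On `succSet n k` the `n`-th failure occurs at toss `k + n`, and not before. -/
lemma card_of_mem_succSet {n k : ℕ} {b : ℕ → Bool} (h : b ∈ succSet n k) :
    ((Finset.range (k + n)).filter fun j => b j = false).card = n ∧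
      ∀ L < k + n, ((Finset.range L).filter fun j => b j = false).card < n ∨ n = 0 := by
  induction n, k using succSet.induct generalizing b with
  | case1 => simp
  | case2 => simp [succSet] at h
  | case3 n ih =>
    simp only [succSet, branchSet, Set.mem_ofPred_eq, Set.mem_empty_iff_false, and_false,
      false_or] at h
    obtain ⟨h1, h2⟩ := ih h.2
    refine ⟨?_, fun L hL => ?_⟩
    · rw [show 0 + (n + 1) = 0 + n + 1 by ring, card_filter_range_succ, h1, if_pos h.1]
    · refine Or.inl ?_
      have := Finset.card_filter_le (Finset.range L) fun j => b j = false
      rw [Finset.card_range] at this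
      omega
  | case4 n k ih₁ ih₀ =>
    simp only [succSet, branchSet, Set.mem_ofPred_eq] at h
    rcases h with ⟨h0, h⟩ | ⟨h0, h⟩
    · obtain ⟨h1, h2⟩ := ih₁ h
      refine ⟨?_, fun L hL => Or.inl ?_⟩
      · rw [show k + 1 + (n + 1) = k + (n + 1) + 1 by ring, card_filter_range_succ, h1, h0]
        simp
      · rcases L with - | L
        · simp
        · rw [card_filter_range_succ, h0]
          have := h2 L (by omega)
          simpa using this
    · obtain ⟨h1, h2⟩ := ih₀ h
      refine ⟨?_, fun L hL => Or.inl ?_⟩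
      · rw [show k + 1 + (n + 1) = k + 1 + n + 1 by ring, card_filter_range_succ, h1, h0]
        simp
      · rcases L with - | L
        · simp
        · rw [card_filter_range_succ, h0]
          have := h2 L (by omega)
          rcases this with this | this
          · simpa using this
          · subst this
            exfalso
            simp [succSet] at h

lemma numSucc_of_mem_succSet {n k : ℕ} {b : ℕ → Bool} (h : b ∈ succSet (n + 1) k) :
    numSucc b (n + 1) = k := by
  obtain ⟨h1, h2⟩ := card_of_mem_succSet h
  refine le_antisymm (Nat.sInf_le h1) ?_
  refine le_csInf ⟨k, h1⟩ fun l hl => ?_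
  by_contra! hlt
  rcases h2 (l + (n + 1)) (by omega) with h3 | h3
  · exact h3.ne hl
  · omega

end Sequences

section CookieSite

variable {N : ℕ} {Ω : Type*} [MeasurableSpace Ω] {Pm : Measure Ω}
  {K : Matrix (Fin N) (Fin N) ℝ} {p η : Fin N → ℝ} {Rc : ℕ → Ω → Fin N} {ξ : ℕ → Ω → Bool}

/-- The event that the environment and the tosses up to time `t` agree with `f` and `b`. -/
def prefixEvent (Rc : ℕ → Ω → Fin N) (ξ : ℕ → Ω → Bool) (t : ℕ) (f : ℕ → Fin N) (b : ℕ → Bool) :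
    Set Ω :=
  {ω | ∀ j ≤ t, Rc j ω = f j ∧ ξ j ω = b j}

/-- The event that the tosses from time `t` on form a sequence in `S`. -/
def tailEvent (ξ : ℕ → Ω → Bool) (t : ℕ) (S : Set (ℕ → Bool)) : Set Ω :=
  {ω | (fun j => ξ (t + j) ω) ∈ S}

/-- Success or failure probability of a toss. -/
def tossProb (p : Fin N → ℝ) (y : Bool) (i : Fin N) : ℝ := if y then p i else 1 - p i

/-- Probability of `prefixEvent`. -/
def prefixWeight (K : Matrix (Fin N) (Fin N) ℝ) (p η : Fin N → ℝ) (t : ℕ) (f : ℕ → Fin N)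
    (b : ℕ → Bool) : ℝ :=
  η (f 0) * (∏ j ∈ Finset.range t, K (f j) (f (j + 1))) *
    ∏ j ∈ Finset.range (t + 1), tossProb p (b j) (f j)

/-- Given the past up to time `t`, the future tosses lie in `S` with conditional probability
`K v` evaluated at the current environment state. -/
def HasTailLaw (Pm : Measure Ω) (K : Matrix (Fin N) (Fin N) ℝ) (p η : Fin N → ℝ)
    (Rc : ℕ → Ω → Fin N) (ξ : ℕ → Ω → Bool) (S : Set (ℕ → Bool)) (v : Fin N → ℝ) : Prop :=
  MeasurableSet S ∧ ∀ t f b, Pm.real (prefixEvent Rc ξ t f b ∩ tailEvent ξ (t + 1) S) =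
    prefixWeight K p η t f b * (K *ᵥ v) (f t)

lemma measurableSet_branchSet {S₁ S₀ : Set (ℕ → Bool)} (h₁ : MeasurableSet S₁)
    (h₀ : MeasurableSet S₀) : MeasurableSet (branchSet S₁ S₀) := by
  have hshift : Measurable fun (b : ℕ → Bool) j => b (j + 1) :=
    measurable_pi_lambda _ fun j => measurable_pi_apply (j + 1)
  have hzero : ∀ y, MeasurableSet {b : ℕ → Bool | b 0 = y} := fun y =>
    (measurable_pi_apply 0 : Measurable fun b : ℕ → Bool => b 0) (measurableSet_singleton y)
  exact ((hzero true).inter (hshift h₁)).union ((hzero false).inter (hshift h₀))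

lemma measurableSet_tailEvent (h : IsCookieSite Pm K p η Rc ξ) (t : ℕ) {S : Set (ℕ → Bool)}
    (hS : MeasurableSet S) : MeasurableSet (tailEvent ξ t S) :=
  (measurable_pi_lambda _ fun j => h.2.1 (t + j) :
    Measurable fun ω j => ξ (t + j) ω) hS

lemma measurableSet_prefixEvent (h : IsCookieSite Pm K p η Rc ξ) (t : ℕ) (f : ℕ → Fin N)
    (b : ℕ → Bool) : MeasurableSet (prefixEvent Rc ξ t f b) := by
  have : prefixEvent Rc ξ t f b = ⋂ j, ⋂ (_ : j ≤ t), Rc j ⁻¹' {f j} ∩ ξ j ⁻¹' {b j} := by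
    ext ω
    simp [prefixEvent]
  rw [this]
  exact MeasurableSet.iInter fun j => MeasurableSet.iInter fun _ =>
    (h.1 j (measurableSet_singleton _)).inter (h.2.1 j (measurableSet_singleton _))

lemma measureReal_prefixEvent (h : IsCookieSite Pm K p η Rc ξ) (t : ℕ) (f : ℕ → Fin N)
    (b : ℕ → Bool) : Pm.real (prefixEvent Rc ξ t f b) = prefixWeight K p η t f b :=
  h.2.2 t f b

lemma measureReal_eq_sum_fiber [IsFiniteMeasure Pm] {ι : Type*} [Fintype ι] {E : Set Ω}
    {F : ι → Set Ω} (hF : ∀ c, MeasurableSet (F c)) {Z : Ω → ι}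
    (hEF : ∀ c ω, ω ∈ F c ↔ ω ∈ E ∧ Z ω = c) : Pm.real E = ∑ c, Pm.real (F c) := by
  have hunion : E = ⋃ c, F c := by
    ext ω
    simp [hEF]
  rw [hunion]
  refine measureReal_iUnion_fintype ?_ hF
  intro c c' hcc
  refine Set.disjoint_left.2 fun ω h1 h2 => hcc ?_
  rw [← ((hEF c ω).1 h1).2, ((hEF c' ω).1 h2).2]

lemma hasTailLaw_univ (hK : IsStochastic K) (h : IsCookieSite Pm K p η Rc ξ) :
    HasTailLaw Pm K p η Rc ξ Set.univ 1 := by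
  refine ⟨MeasurableSet.univ, fun t f b => ?_⟩
  rw [hK.mulVec_one_s11, mul_one, ← measureReal_prefixEvent h]
  simp [tailEvent]

lemma hasTailLaw_empty : HasTailLaw Pm K p η Rc ξ ∅ 0 :=
  ⟨MeasurableSet.empty, fun t f b => by simp [tailEvent]⟩

lemma mem_tailEvent_branchSet {S : Bool → Set (ℕ → Bool)} {t : ℕ} {ω : Ω} :
    ω ∈ tailEvent ξ t (branchSet (S true) (S false)) ↔ ω ∈ tailEvent ξ (t + 1) (S (ξ t ω)) := by
  have : (fun j => ξ (t + (j + 1)) ω) = fun j => ξ (t + 1 + j) ω := by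
    ext j
    rw [add_right_comm, add_assoc]
  simp only [tailEvent, branchSet, Set.mem_ofPred_eq, add_zero, this]
  cases ξ t ω <;> simp

lemma prefixWeight_update (t : ℕ) (f : ℕ → Fin N) (b : ℕ → Bool) (x : Fin N) (y : Bool) :
    prefixWeight K p η (t + 1) (Function.update f (t + 1) x) (Function.update b (t + 1) y) =
      prefixWeight K p η t f b * (K (f t) x * tossProb p y x) := by
  have h0 : Function.update f (t + 1) x 0 = f 0 := Function.update_of_ne (by omega) _ _
  have h1 : ∏ j ∈ Finset.range t,
      K (Function.update f (t + 1) x j) (Function.update f (t + 1) x (j + 1)) =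
      ∏ j ∈ Finset.range t, K (f j) (f (j + 1)) := Finset.prod_congr rfl fun j hj => by
    have := Finset.mem_range.1 hj
    rw [Function.update_of_ne (by omega), Function.update_of_ne (by omega)]
  have h2 : ∏ j ∈ Finset.range (t + 1),
      tossProb p (Function.update b (t + 1) y j) (Function.update f (t + 1) x j) =
      ∏ j ∈ Finset.range (t + 1), tossProb p (b j) (f j) := Finset.prod_congr rfl fun j hj => by
    have := Finset.mem_range.1 hj
    rw [Function.update_of_ne (by omega), Function.update_of_ne (by omega)]
  have h3 : Function.update f (t + 1) x t = f t := Function.update_of_ne (by omega) _ _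
  rw [prefixWeight, Finset.prod_range_succ, Finset.prod_range_succ _ (t + 1), h0, h1, h2, h3,
    Function.update_self, Function.update_self, prefixWeight]
  ring

lemma sum_tossProb (v : Bool → Fin N → ℝ) (c : Fin N → ℝ) :
    ∑ z : Fin N × Bool, c z.1 * tossProb p z.2 z.1 * (K *ᵥ v z.2) z.1 =
      ∑ i, c i * branchLaw K p (v true) (v false) i := by
  rw [Fintype.sum_prod_type]
  refine Finset.sum_congr rfl fun i _ => ?_
  simp [tossProb, branchLaw]
  ring

lemma HasTailLaw.branchSet [IsFiniteMeasure Pm] (h : IsCookieSite Pm K p η Rc ξ)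
    {S : Bool → Set (ℕ → Bool)} {v : Bool → Fin N → ℝ}
    (hS : ∀ y, HasTailLaw Pm K p η Rc ξ (S y) (v y)) :
    HasTailLaw Pm K p η Rc ξ (branchSet (S true) (S false))
      (branchLaw K p (v true) (v false)) := by
  refine ⟨measurableSet_branchSet (hS true).1 (hS false).1, fun t f b => ?_⟩
  rw [measureReal_eq_sum_fiber (ι := Fin N × Bool)
    (F := fun z => prefixEvent Rc ξ (t + 1) (Function.update f (t + 1) z.1)
      (Function.update b (t + 1) z.2) ∩ tailEvent ξ (t + 1 + 1) (S z.2))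
    (Z := fun ω => (Rc (t + 1) ω, ξ (t + 1) ω))
    (fun z => (measurableSet_prefixEvent h _ _ _).inter
      (measurableSet_tailEvent h _ (hS z.2).1))]
  · simp only [(hS _).2, prefixWeight_update, Function.update_self]
    calc _ = prefixWeight K p η t f b *
        ∑ z : Fin N × Bool, K (f t) z.1 * tossProb p z.2 z.1 * (K *ᵥ v z.2) z.1 := by
          rw [Finset.mul_sum]
          exact Finset.sum_congr rfl fun z _ => by ring
      _ = _ := by
        rw [sum_tossProb]
        rfl
  · rintro ⟨x, y⟩ ω
    simp only [Set.mem_inter_iff, mem_tailEvent_branchSet, Prod.mk.injEq]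
    have hpre : ω ∈ prefixEvent Rc ξ (t + 1) (Function.update f (t + 1) x)
        (Function.update b (t + 1) y) ↔
        ω ∈ prefixEvent Rc ξ t f b ∧ Rc (t + 1) ω = x ∧ ξ (t + 1) ω = y := by
      simp only [prefixEvent, Set.mem_ofPred_eq]
      constructor
      · intro H
        refine ⟨fun j hj => ?_, by simpa using H (t + 1) le_rfl⟩
        have := H j (by omega)
        rwa [Function.update_of_ne (by omega), Function.update_of_ne (by omega)] at this
      · rintro ⟨H, H'⟩ j hj
        rcases Nat.le_succ_iff.1 hj with hj | rfl
        · rw [Function.update_of_ne (by omega), Function.update_of_ne (by omega)]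
          exact H j hj
        · simpa using H'
    rw [hpre]
    constructor
    · rintro ⟨⟨h1, rfl, rfl⟩, h3⟩
      exact ⟨⟨h1, h3⟩, rfl, rfl⟩
    · rintro ⟨⟨h1, h3⟩, rfl, rfl⟩
      exact ⟨⟨h1, rfl, rfl⟩, h3⟩

lemma measureReal_branchSet [IsFiniteMeasure Pm] (h : IsCookieSite Pm K p η Rc ξ)
    {S : Bool → Set (ℕ → Bool)} {v : Bool → Fin N → ℝ}
    (hS : ∀ y, HasTailLaw Pm K p η Rc ξ (S y) (v y)) :
    Pm.real (tailEvent ξ 0 (branchSet (S true) (S false))) =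
      ∑ i, η i * branchLaw K p (v true) (v false) i := by
  rw [measureReal_eq_sum_fiber (ι := Fin N × Bool)
    (F := fun z => prefixEvent Rc ξ 0 (fun _ => z.1) (fun _ => z.2) ∩ tailEvent ξ (0 + 1) (S z.2))
    (Z := fun ω => (Rc 0 ω, ξ 0 ω))
    (fun z => (measurableSet_prefixEvent h _ _ _).inter
      (measurableSet_tailEvent h _ (hS z.2).1))]
  · rw [← sum_tossProb]
    refine Finset.sum_congr rfl fun z _ => ?_
    rw [(hS z.2).2]
    simp [prefixWeight]
  · rintro ⟨x, y⟩ ω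
    simp only [Set.mem_inter_iff, mem_tailEvent_branchSet, Prod.mk.injEq, prefixEvent,
      Set.mem_ofPred_eq, Nat.le_zero, forall_eq]
    constructor
    · rintro ⟨⟨rfl, rfl⟩, h3⟩
      exact ⟨h3, rfl, rfl⟩
    · rintro ⟨h3, rfl, rfl⟩
      exact ⟨⟨rfl, rfl⟩, h3⟩

lemma hasTailLaw_succSet [IsFiniteMeasure Pm] (hK : IsStochastic K)
    (h : IsCookieSite Pm K p η Rc ξ) (n k : ℕ) :
    HasTailLaw Pm K p η Rc ξ (succSet n k) (succLaw K p n k) := by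
  induction n, k using succSet.induct with
  | case1 => simpa only [succSet, succLaw] using hasTailLaw_univ hK h
  | case2 => simpa only [succSet, succLaw] using hasTailLaw_empty
  | case3 n ih =>
    rw [succSet, succLaw]
    exact HasTailLaw.branchSet h (S := fun y => bif y then ∅ else succSet n 0)
      (v := fun y => bif y then 0 else succLaw K p n 0)
      (fun y => by cases y; exacts [ih, hasTailLaw_empty])
  | case4 n k ih₁ ih₀ =>
    rw [succSet, succLaw]
    exact HasTailLaw.branchSet h (S := fun y => bif y then succSet (n + 1) k else succSet n (k + 1))
      (v := fun y => bif y then succLaw K p (n + 1) k else succLaw K p n (k + 1))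
      (fun y => by cases y; exacts [ih₀, ih₁])

lemma measureReal_succSet [IsFiniteMeasure Pm] (hK : IsStochastic K)
    (h : IsCookieSite Pm K p η Rc ξ) (n k : ℕ) :
    Pm.real (tailEvent ξ 0 (succSet (n + 1) k)) = ∑ i, η i * succLaw K p (n + 1) k i := by
  cases k with
  | zero =>
    rw [succSet, succLaw]
    exact measureReal_branchSet h (S := fun y => bif y then ∅ else succSet n 0)
      (v := fun y => bif y then 0 else succLaw K p n 0)
      (fun y => by cases y; exacts [hasTailLaw_succSet hK h _ _, hasTailLaw_empty])
  | succ k =>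
    rw [succSet, succLaw]
    exact measureReal_branchSet h
      (S := fun y => bif y then succSet (n + 1) k else succSet n (k + 1))
      (v := fun y => bif y then succLaw K p (n + 1) k else succLaw K p n (k + 1))
      (fun y => by cases y <;> exact hasTailLaw_succSet hK h _ _)

lemma hasSum_succLaw_average {φ : ℕ → ℝ} {n : ℕ}
    (hφ : ∀ i, Summable fun k => φ k * succLaw K p n k i) :
    HasSum (fun k => φ k * ∑ i, η i * succLaw K p n k i) (∑ i, η i * succMean K p φ n i) := by
  refine (hasSum_sum (s := Finset.univ) fun i _ => (hφ i).hasSum.mul_left (η i)).congr_fun ?_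
  intro k
  rw [Finset.mul_sum]
  exact Finset.sum_congr rfl fun i _ => by ring

lemma mem_tailEvent_succSet_iff [IsProbabilityMeasure Pm] (hK : IsStochastic K)
    (hp : ∀ i, p i ∈ Set.Ioo (0 : ℝ) 1) (hη : IsProbVec η) (h : IsCookieSite Pm K p η Rc ξ)
    (n : ℕ) : ∀ᵐ ω ∂Pm, ∀ k, numSucc (fun j => ξ j ω) (n + 1) = k ↔
      ω ∈ tailEvent ξ 0 (succSet (n + 1) k) := by
  have hmeas : ∀ k, MeasurableSet (tailEvent ξ 0 (succSet (n + 1) k)) := fun k =>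
    measurableSet_tailEvent h 0 (hasTailLaw_succSet hK h (n + 1) k).1
  have hval : ∀ k ω, ω ∈ tailEvent ξ 0 (succSet (n + 1) k) →
      numSucc (fun j => ξ j ω) (n + 1) = k := fun k ω hω => by
    simp only [tailEvent, Set.mem_ofPred_eq, zero_add] at hω
    exact numSucc_of_mem_succSet hω
  have hdisj : Pairwise (Function.onFun Disjoint fun k => tailEvent ξ 0 (succSet (n + 1) k)) :=
    fun k l hkl => Set.disjoint_left.2 fun ω h1 h2 => hkl ((hval k ω h1).symm.trans (hval l ω h2))
  have hsum : HasSum (fun k => ∑ i, η i * succLaw K p (n + 1) k i) 1 := by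
    have := hasSum_succLaw_average (η := η) (φ := fun _ => 1) (n := n + 1) (K := K) (p := p)
      fun i => by simpa using summable_pow_mul_succLaw hK hp 0 (n + 1) i
    simpa [succMean_one hK hp, hη.2] using this
  have hfull : Pm (⋃ k, tailEvent ξ 0 (succSet (n + 1) k)) = 1 := by
    rw [measure_iUnion hdisj hmeas, ← ENNReal.ofReal_one, ← hsum.tsum_eq,
      ENNReal.ofReal_tsum_of_nonneg _ hsum.summable]
    · exact tsum_congr fun k => by rw [← measureReal_succSet hK h, ofReal_measureReal]
    · exact fun k => Finset.sum_nonneg fun i _ => mul_nonneg (hη.1 i) (succLaw_nonneg hK hp _ _ i)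
  have hae : ∀ᵐ ω ∂Pm, ω ∈ ⋃ k, tailEvent ξ 0 (succSet (n + 1) k) :=
    (prob_compl_eq_zero_iff (MeasurableSet.iUnion hmeas)).2 hfull
  filter_upwards [hae] with ω hω k
  obtain ⟨l, hl⟩ := Set.mem_iUnion.1 hω
  refine ⟨fun hk => ?_, hval k ω⟩
  rwa [← hk, hval l ω hl]

lemma aemeasurable_numSucc [IsProbabilityMeasure Pm] (hK : IsStochastic K)
    (hp : ∀ i, p i ∈ Set.Ioo (0 : ℝ) 1) (hη : IsProbVec η) (h : IsCookieSite Pm K p η Rc ξ)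
    (n : ℕ) : AEMeasurable (fun ω => numSucc (fun j => ξ j ω) (n + 1)) Pm := by
  refine NullMeasurable.aemeasurable fun s _ => ?_
  have hmeas : MeasurableSet (⋃ k ∈ s, tailEvent ξ 0 (succSet (n + 1) k)) :=
    MeasurableSet.biUnion s.to_countable fun k _ =>
      measurableSet_tailEvent h 0 (hasTailLaw_succSet hK h (n + 1) k).1
  refine hmeas.nullMeasurableSet.congr ?_
  filter_upwards [mem_tailEvent_succSet_iff hK hp hη h n] with ω hω
  refine propext (Iff.trans (b := ∃ k ∈ s, ω ∈ tailEvent ξ 0 (succSet (n + 1) k)) ?_ ?_)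
  · exact Set.mem_iUnion₂.trans (by simp)
  · simp only [← hω]
    exact ⟨fun ⟨k, hk, hk'⟩ => by subst hk'; exact hk, fun hk => ⟨_, hk, rfl⟩⟩

lemma measureReal_map_numSucc [IsProbabilityMeasure Pm] (hK : IsStochastic K)
    (hp : ∀ i, p i ∈ Set.Ioo (0 : ℝ) 1) (hη : IsProbVec η) (h : IsCookieSite Pm K p η Rc ξ)
    (n k : ℕ) : (Pm.map fun ω => numSucc (fun j => ξ j ω) (n + 1)).real {k} =
      ∑ i, η i * succLaw K p (n + 1) k i := by
  rw [← measureReal_succSet hK h, measureReal_def, measureReal_def,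
    Measure.map_apply_of_aemeasurable (aemeasurable_numSucc hK hp hη h n)
      (measurableSet_singleton k)]
  congr 1
  refine measure_congr ?_
  filter_upwards [mem_tailEvent_succSet_iff hK hp hη h n] with ω hω
  exact propext (hω k)

lemma integrable_and_integral_numSucc [IsProbabilityMeasure Pm] (hK : IsStochastic K)
    (hp : ∀ i, p i ∈ Set.Ioo (0 : ℝ) 1) (hη : IsProbVec η) (h : IsCookieSite Pm K p η Rc ξ)
    (n : ℕ) {φ : ℕ → ℝ} (hφ0 : ∀ k, 0 ≤ φ k)
    (hφ : ∀ i, Summable fun k => φ k * succLaw K p (n + 1) k i) :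
    Integrable (fun ω => φ (numSucc (fun j => ξ j ω) (n + 1))) Pm ∧
      ∫ ω, φ (numSucc (fun j => ξ j ω) (n + 1)) ∂Pm = ∑ i, η i * succMean K p φ (n + 1) i := by
  have hX := aemeasurable_numSucc hK hp hη h n
  set X := fun ω => numSucc (fun j => ξ j ω) (n + 1)
  have : IsProbabilityMeasure (Pm.map X) := Measure.isProbabilityMeasure_map hX
  have hsum := hasSum_succLaw_average (η := η) hφ
  have hmass := measureReal_map_numSucc hK hp hη h n
  have hφmeas : AEStronglyMeasurable φ (Pm.map X) :=
    (measurable_of_countable φ).aestronglyMeasurable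
  have hint : Integrable φ (Pm.map X) := by
    refine ⟨hφmeas, ?_⟩
    rw [hasFiniteIntegral_iff_ofReal (Eventually.of_forall hφ0), lintegral_countable']
    convert hsum.summable.tsum_ofReal_lt_top using 3 with k
    rw [← hmass, ENNReal.ofReal_mul (hφ0 k), ofReal_measureReal]
  refine ⟨hint.comp_aemeasurable hX, ?_⟩
  rw [← integral_map hX hφmeas, integral_countable hint, ← hsum.tsum_eq]
  exact tsum_congr fun k => by rw [hmass, smul_eq_mul, mul_comm]

lemma variance_numSucc [IsProbabilityMeasure Pm] (hK : IsStochastic K)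
    (hp : ∀ i, p i ∈ Set.Ioo (0 : ℝ) 1) (hη : IsProbVec η) (h : IsCookieSite Pm K p η Rc ξ)
    (n : ℕ) : variance (fun ω => (numSucc (fun j => ξ j ω) (n + 1) : ℝ)) Pm =
      ∑ i, η i * succMean K p (fun k => (k : ℝ) ^ 2) (n + 1) i -
        (∑ i, η i * succMean K p (fun k => (k : ℝ)) (n + 1) i) ^ 2 := by
  obtain ⟨h1, h1'⟩ := integrable_and_integral_numSucc hK hp hη h n (φ := fun k => (k : ℝ))
    (fun k => k.cast_nonneg) fun i => by simpa using summable_pow_mul_succLaw hK hp 1 (n + 1) i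
  obtain ⟨h2, h2'⟩ := integrable_and_integral_numSucc hK hp hη h n (φ := fun k => (k : ℝ) ^ 2)
    (fun k => by positivity) fun i => summable_pow_mul_succLaw hK hp 2 (n + 1) i
  rw [variance_eq_sub ((memLp_two_iff_integrable_sq h1.aestronglyMeasurable).2 h2), h1', ← h2']
  rfl

end CookieSite

/-- **Proposition 3.4 (variance of the forward BLP).** There is a constant `C > 0`, uniform
in the initial distribution `η`, such that `|Var_η(U₁ | U₀ = n)/n − ν| ≤ C/n` for all
`n ≥ 1`, where `ν = (1+λ)(λ + 2 μD_pK𝐫)`. In particular, if `p̄ = 1/2` then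
`ν = 2 + 4 μD_pK𝐫 = 4 μD_pK (I − K + 2(𝟏−𝐩)μD_{1−p}K)⁻¹𝐩`. -/
theorem forward_BLP_variance_asymptotics
    {N : ℕ} {Ω : Type*} [MeasurableSpace Ω]
    (K : Matrix (Fin N) (Fin N) ℝ) (μ p : Fin N → ℝ)
    (Rc : ℕ → Ω → Fin N) (ξ : ℕ → Ω → Bool)
    (Pfam : (Fin N → ℝ) → Measure Ω)
    (hK : IsStochastic K) (hμ : HasUniqueStationaryDist K μ)
    (hp : ∀ i, p i ∈ Set.Ioo (0 : ℝ) 1)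
    (henv : ∀ η : Fin N → ℝ, IsProbVec η →
      IsProbabilityMeasure (Pfam η) ∧ IsCookieSite (Pfam η) K p η Rc ξ)
    (lam ν : ℝ) (hlam : lam = (∑ i, μ i * p i) / (1 - ∑ i, μ i * p i))
    (hν : ν = (1 + lam) *
      (lam + 2 * ∑ i, Matrix.vecMul μ (Matrix.diagonal p * K) i * rvecGen K μ p i)) :
    (∃ C : ℝ, 0 < C ∧
      ∀ (n : ℕ), 1 ≤ n → ∀ η : Fin N → ℝ, IsProbVec η →
        |variance (fun ω => (numSucc (fun j => ξ j ω) n : ℝ)) (Pfam η) / n - ν| ≤ C / n) ∧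
    (∑ i, μ i * p i = 1 / 2 →
      ν = 2 + 4 * ∑ i, Matrix.vecMul μ (Matrix.diagonal p * K) i * rvecGen K μ p i ∧
      ν = 4 * ∑ i, Matrix.vecMul μ (Matrix.diagonal p * K) i *
        Matrix.mulVec
          (1 - K + (2 : ℝ) •
              Matrix.vecMulVec (fun i' => 1 - p i')
                (Matrix.vecMul μ (Matrix.diagonal (fun i' => 1 - p i') * K)))⁻¹ p i) := by
  constructor
  · obtain ⟨C, hC, hbound⟩ := exists_variance_bound hK hμ hp hlam hν
      (M := succMean K p fun k => (k : ℝ)) (Q := succMean K p fun k => (k : ℝ) ^ 2)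
      (by ext i; simp [succMean_zero])
      (succMean_id_succ hK hp) (succMean_sq_succ hK hp)
    refine ⟨C, hC, fun n hn η hη => ?_⟩
    obtain ⟨hprob, hsite⟩ := henv η hη
    obtain ⟨m, rfl⟩ := Nat.exists_eq_succ_of_ne_zero (by omega : n ≠ 0)
    have hm : (0 : ℝ) < (m.succ : ℕ) := by positivity
    rw [variance_numSucc hK hp hη hsite, div_sub' hm.ne', abs_div, abs_of_pos hm]
    gcongr
    exact hbound (m + 1) η hη
  · intro hhalf
    have hlam1 : lam = 1 := by rw [hlam, hhalf]; norm_num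
    have hmatrix : poissonMatrix K μ p = 1 - K + (2 : ℝ) •
        Matrix.vecMulVec (fun i' => 1 - p i')
          (Matrix.vecMul μ (Matrix.diagonal (fun i' => 1 - p i') * K)) := by
      rw [poissonMatrix, hhalf]
      norm_num
    have hr : ∀ i, (poissonMatrix K μ p)⁻¹.mulVec p i = rvecGen K μ p i + 1 := fun i => by
      simp [rvecGen, poissonMatrix, ← hlam, hlam1]
    have hone : ∑ i, Matrix.vecMul μ (Matrix.diagonal p * K) i = 1 / 2 := by
      have := sum_vecMul_diagonal_mul (K := K) (μ := μ) p (fun _ => 1)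
      simpa only [hK.mulVec_const, mul_one, hhalf] using this
    rw [← hmatrix]
    simp only [hr, mul_add, mul_one, Finset.sum_add_distrib, hone]
    rw [hν, hlam1]
    constructor <;> ring

end
end
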